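/- arXiv:1806.00652 — 2 statements merged into one kernel-verified Lean document; each statement's English description precedes it below -/
import Mathlib

section
/- Let a < b, let f, D : [a,b] → ℝ be C¹, and assume D(ρ) > 0 for all ρ ∈ (a,b). Let s(ρ) := f(a) + ((f(b) − f(a))/(b − a))(ρ − a). Then: (a1) the equation ρ_t + f(ρ)_x = (D(ρ)ρ_x)_x admits a wavefront whose profile φ satisfies φ(−∞) = a, φ(+∞) = b if and only if f(ρ) > s(ρ) for all ρ ∈ (a,b); (a2) it admits a wavefront with φ(−∞) = b, φ(+∞) = a if and only if f(ρ) < s(ρ) for all ρ ∈ (a,b). In either case the wave speed equals (f(b) − f(a))/(b − a), the profile is unique up to shifts, is C² and strictly monotone on J := {ξ : a < φ(ξ) < b} (increasing in case (a1), decreasing in case (a2)). -/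
open Set Filter MeasureTheory Topology

/-- A traveling-wave profile of `ρ_t + f(ρ)_x = (D(ρ)ρ_x)_x`, valued in `[a,b]`,
with speed `c`: a continuous `φ : ℝ → [a,b]`, differentiable off a countable set,
with `D(φ)φ'` locally integrable, satisfying the weak form of the profile ODE. -/
def IsTWProfile (a b : ℝ) (f D : ℝ → ℝ) (c : ℝ) (φ : ℝ → ℝ) : Prop :=
  Continuous φ ∧ (∀ ξ, φ ξ ∈ Icc a b) ∧
  (∃ S : Set ℝ, S.Countable ∧ ∀ ξ ∉ S, DifferentiableAt ℝ φ ξ) ∧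
  LocallyIntegrable (fun ξ => D (φ ξ) * deriv φ ξ) ∧
  ∀ ψ : ℝ → ℝ, ContDiff ℝ (⊤ : ℕ∞) ψ → HasCompactSupport ψ →
    ∫ ξ, (D (φ ξ) * deriv φ ξ - f (φ ξ) + c * φ ξ) * deriv ψ ξ = 0

/-- A wavefront from `ℓm` to `ℓp`: a monotone, non-constant traveling-wave
profile with limits `ℓm` at `-∞` and `ℓp` at `+∞`. -/
def IsWavefront (a b : ℝ) (f D : ℝ → ℝ) (c ℓm ℓp : ℝ) (φ : ℝ → ℝ) : Prop :=
  IsTWProfile a b f D c φ ∧ (Monotone φ ∨ Antitone φ) ∧ (∃ x y, φ x ≠ φ y) ∧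
  Tendsto φ atBot (𝓝 ℓm) ∧ Tendsto φ atTop (𝓝 ℓp)

/-- A compactly supported smooth function with zero integral is the derivative of one. -/
lemma aux_primitive (g : ℝ → ℝ) (hg : ContDiff ℝ (⊤ : ℕ∞) g) (hc : HasCompactSupport g)
    (h0 : ∫ x, g x = 0) : ∃ ψ : ℝ → ℝ, ContDiff ℝ (⊤ : ℕ∞) ψ ∧ HasCompactSupport ψ ∧
      deriv ψ = g := by
  obtain ⟨R, hR⟩ := hc.isCompact.isBounded.subset_closedBall 0
  have hz : ∀ x, R < |x| → g x = 0 := by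
    intro x hx
    by_contra h
    have := hR (subset_tsupport g h)
    simp at this
    linarith
  have hgi : Integrable g := hg.continuous.integrable_of_hasCompactSupport hc
  have hd : ∀ x, HasDerivAt (fun u => ∫ t in (-(|R|+1))..u, g t) (g x) x := fun x =>
    (hg.continuous.integral_hasStrictDerivAt _ x).hasDerivAt
  have hder : deriv (fun u => ∫ t in (-(|R|+1))..u, g t) = g := funext fun x => (hd x).deriv
  refine ⟨fun u => ∫ t in (-(|R|+1))..u, g t, ?_, ?_, hder⟩
  · rw [show ((⊤ : ℕ∞) : WithTop ℕ∞) = ((⊤ : ℕ∞) : WithTop ℕ∞) + 1 by rfl,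
      contDiff_succ_iff_deriv]
    refine ⟨fun x => (hd x).differentiableAt, by simp, ?_⟩
    rw [hder]; exact hg
  · refine HasCompactSupport.intro (isCompact_Icc (a := -(|R|+1)) (b := |R|+1)) ?_
    intro x hx
    rw [mem_Icc, not_and_or, not_le, not_le] at hx
    have hRR := le_abs_self R
    rcases hx with hx | hx
    · apply intervalIntegral.integral_zero_ae
      refine Eventually.of_forall fun t ht => hz t ?_
      rw [uIoc_of_ge hx.le] at ht
      rw [lt_abs]; right; linarith [ht.2]
    · have h1 : ∫ t in Ioc (-(|R|+1)) x, g t = ∫ t, g t := by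
        apply setIntegral_eq_integral_of_forall_compl_eq_zero
        intro t ht
        rw [mem_Ioc, not_and_or, not_lt, not_le] at ht
        apply hz
        rw [lt_abs]
        rcases ht with ht | ht
        · right; linarith
        · left; linarith
      rw [intervalIntegral.integral_of_le (by linarith [abs_nonneg R]), h1, h0]

/-- du Bois-Reymond lemma. -/
lemma aux_dbr (u : ℝ → ℝ) (hu : LocallyIntegrable u)
    (h : ∀ ψ : ℝ → ℝ, ContDiff ℝ (⊤ : ℕ∞) ψ → HasCompactSupport ψ →
      ∫ x, u x * deriv ψ x = 0) : ∃ C : ℝ, ∀ᵐ x, u x = C := by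
  let B : ContDiffBump (0 : ℝ) := default
  let p : ℝ → ℝ := B.normed volume
  have hp : ContDiff ℝ (⊤ : ℕ∞) p := B.contDiff_normed
  have hpc : HasCompactSupport p := B.hasCompactSupport_normed
  have hp1 : ∫ x, p x = 1 := B.integral_normed
  have hmul : ∀ g : ℝ → ℝ, ContDiff ℝ (⊤ : ℕ∞) g → HasCompactSupport g →
      Integrable (fun x => u x * g x) := fun g hg hgc => by
    have := hu.integrable_smul_left_of_hasCompactSupport hg.continuous hgc
    simpa [mul_comm] using this
  have hint : ∀ g : ℝ → ℝ, ContDiff ℝ (⊤ : ℕ∞) g → HasCompactSupport g → Integrable g :=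
    fun g hg hgc => hg.continuous.integrable_of_hasCompactSupport hgc
  refine ⟨∫ x, u x * p x, ?_⟩
  have := ae_eq_zero_of_integral_contDiff_smul_eq_zero (μ := volume)
    (f := fun x => u x - ∫ x, u x * p x) (hu.sub (locallyIntegrable_const _)) ?_
  · filter_upwards [this] with x hx
    linarith
  · intro g hg hgc
    obtain ⟨ψ, h1, h2, h3⟩ := aux_primitive (fun x => g x - (∫ y, g y) * p x)
      (hg.sub (contDiff_const.mul hp)) (hgc.sub hpc.mul_left) (by
        rw [integral_sub (hint g hg hgc) ((hint p hp hpc).const_mul _), integral_const_mul, hp1]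
        ring)
    have h4 := h ψ h1 h2
    rw [h3] at h4
    have h5 : ∀ x, u x * (g x - (∫ y, g y) * p x) = u x * g x - (∫ y, g y) * (u x * p x) := by
      intro x; ring
    simp_rw [h5] at h4
    rw [integral_sub (hmul g hg hgc) ((hmul p hp hpc).const_mul _), integral_const_mul] at h4
    simp only [smul_eq_mul]
    simp_rw [mul_sub]
    rw [integral_sub (by simpa [mul_comm] using hmul g hg hgc)
      ((hint g hg hgc).mul_const _), integral_mul_const]
    simp_rw [mul_comm (g _) (u _)]
    exact h4

/-- The flux primitive satisfies the integrated ODE everywhere. -/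
lemma aux_flux {a b : ℝ} (hab : a < b) {f D : ℝ → ℝ} {c : ℝ} {φ : ℝ → ℝ}
    (hf : ContinuousOn f (Icc a b)) (hD : ContinuousOn D (Icc a b))
    (h : IsTWProfile a b f D c φ) :
    ∃ (H : ℝ → ℝ) (K : ℝ), (∀ ρ ∈ Icc a b, HasStrictDerivAt H (D ρ) ρ) ∧
      ∀ ξ, HasDerivAt (fun x => H (φ x)) (f (φ ξ) - c * φ ξ + K) ξ := by
  obtain ⟨hc, hm, ⟨S, hS, hdiff⟩, hli, hweak⟩ := h
  have hfc : Continuous (fun ξ => f (φ ξ)) := hf.comp_continuous hc hm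
  have hgc : Continuous (fun ξ => f (φ ξ) - c * φ ξ) := hfc.sub (continuous_const.mul hc)
  obtain ⟨K, hK⟩ := aux_dbr (fun ξ => D (φ ξ) * deriv φ ξ - f (φ ξ) + c * φ ξ)
    ((hli.sub hfc.locallyIntegrable).add (continuous_const.mul hc).locallyIntegrable) hweak
  let Dt : ℝ → ℝ := IccExtend hab.le ((Icc a b).domRestrict D)
  have hDt : Continuous Dt := hD.domRestrict.Icc_extend'
  have hDe : ∀ ρ ∈ Icc a b, Dt ρ = D ρ := fun ρ hρ => by
    simp only [Dt]; rw [IccExtend_of_mem _ _ hρ]; rfl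
  let H : ℝ → ℝ := fun u => ∫ t in a..u, Dt t
  have hH : ∀ ρ, HasStrictDerivAt H (Dt ρ) ρ := fun ρ => hDt.integral_hasStrictDerivAt a ρ
  have hHc : Continuous H := continuous_iff_continuousAt.2 fun ρ => (hH ρ).hasDerivAt.continuousAt
  refine ⟨H, K, fun ρ hρ => hDe ρ hρ ▸ hH ρ, fun ξ => ?_⟩
  have key : ∀ x, H (φ x) = H (φ 0) + ∫ t in (0:ℝ)..x, (f (φ t) - c * φ t + K) := by
    intro x
    have h1 := integral_eq_of_hasDerivAt_off_countable (fun x => H (φ x))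
      (fun ξ => D (φ ξ) * deriv φ ξ) (a := 0) (b := x) hS (hHc.comp hc).continuousOn
      (fun y hy => by
        have := ((hH (φ y)).hasDerivAt).comp y (hdiff y hy.2).hasDerivAt
        rw [hDe _ (hm y)] at this
        exact this)
      (hli.integrableOn_isCompact isCompact_uIcc).intervalIntegrable
    have h2 : ∫ t in (0:ℝ)..x, D (φ t) * deriv φ t = ∫ t in (0:ℝ)..x, (f (φ t) - c * φ t + K) := by
      apply intervalIntegral.integral_congr_ae
      filter_upwards [hK] with t ht _
      linarith
    rw [← h2, h1]; ring
  have h3 : (fun x => H (φ x)) =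
      fun x => H (φ 0) + ∫ t in (0:ℝ)..x, (f (φ t) - c * φ t + K) := funext key
  rw [h3]
  exact (((hgc.add continuous_const).integral_hasStrictDerivAt 0 ξ).hasDerivAt).const_add _

/-- Limit of derivative is zero if the function converges. -/
lemma aux_lim_top {w w' : ℝ → ℝ} (hw : ∀ x, HasDerivAt w (w' x) x) {l m : ℝ}
    (h1 : Tendsto w atTop (𝓝 l)) (h2 : Tendsto w' atTop (𝓝 m)) : m = 0 := by
  have hex : ∀ x : ℝ, ∃ y ∈ Ioo x (x+1), w' y = (w (x+1) - w x) / ((x+1) - x) := fun x =>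
    exists_hasDerivAt_eq_slope w w' (by linarith)
      (fun y _ => (hw y).continuousAt.continuousWithinAt) (fun y _ => hw y)
  choose y hy hyw using hex
  have hyt : Tendsto y atTop atTop := tendsto_atTop_mono (fun x => (hy x).1.le) tendsto_id
  have h3 : Tendsto (fun x => w' (y x)) atTop (𝓝 m) := h2.comp hyt
  have h4 : Tendsto (fun x => w (x+1) - w x) atTop (𝓝 (l - l)) :=
    (h1.comp (tendsto_atTop_add_const_right _ 1 tendsto_id)).sub h1
  have h5 : (fun x => w' (y x)) = fun x => w (x+1) - w x := by
    funext x; rw [hyw]; simp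
  rw [h5] at h3
  simpa using tendsto_nhds_unique h3 h4

lemma aux_lim_bot {w w' : ℝ → ℝ} (hw : ∀ x, HasDerivAt w (w' x) x) {l m : ℝ}
    (h1 : Tendsto w atBot (𝓝 l)) (h2 : Tendsto w' atBot (𝓝 m)) : m = 0 := by
  have := aux_lim_top (w := fun x => w (-x)) (w' := fun x => - w' (-x)) (l := l) (m := -m)
    (fun x => by
      have := (hw (-x)).comp x (hasDerivAt_neg x)
      simpa [Function.comp_def] using this)
    (h1.comp tendsto_neg_atTop_atBot) (h2.comp tendsto_neg_atTop_atBot).neg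
  linarith

lemma aux_monotone {φ : ℝ → ℝ} {a b : ℝ} (hab : a < b) (h : Monotone φ ∨ Antitone φ)
    (h1 : Tendsto φ atBot (𝓝 a)) (h2 : Tendsto φ atTop (𝓝 b)) : Monotone φ := by
  rcases h with h | h
  · exact h
  · exfalso
    have h3 := h.le_of_tendsto h2 0
    have h4 := h.ge_of_tendsto h1 0
    linarith

lemma aux_surj {φ : ℝ → ℝ} {a b : ℝ} (hc : Continuous φ)
    (h1 : Tendsto φ atBot (𝓝 a)) (h2 : Tendsto φ atTop (𝓝 b)) {ρ : ℝ} (hρ : ρ ∈ Ioo a b) :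
    ∃ ξ, φ ξ = ρ := by
  obtain ⟨x, hx⟩ := (h1.eventually_lt_const hρ.1).exists
  obtain ⟨y, hy⟩ := (h2.eventually_const_lt hρ.2).exists
  exact mem_range_of_exists_le_of_exists_ge hc ⟨x, hx.le⟩ ⟨y, hy.le⟩

lemma aux_main {a b : ℝ} (hab : a < b) {f D : ℝ → ℝ}
    (hf : ContDiffOn ℝ 1 f (Icc a b)) (hD : ContDiffOn ℝ 1 D (Icc a b))
    (hDpos : ∀ ρ ∈ Ioo a b, 0 < D ρ) {c : ℝ} {φ : ℝ → ℝ} (h : IsWavefront a b f D c a b φ) :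
    c = (f b - f a) / (b - a) ∧
    (∀ ρ ∈ Ioo a b, f a + (f b - f a) / (b - a) * (ρ - a) < f ρ) ∧
    (∀ ξ, φ ξ ∈ Ioo a b →
      HasDerivAt φ ((f (φ ξ) - (f a + (f b - f a) / (b - a) * (φ ξ - a))) / D (φ ξ)) ξ) := by
  obtain ⟨hp, hmon, -, hbot, htop⟩ := h
  have hmono := aux_monotone hab hmon hbot htop
  obtain ⟨H, K, hH, hw⟩ := aux_flux hab hf.continuousOn hD.continuousOn hp
  obtain ⟨hc, hm, -⟩ := hp
  have haI : a ∈ Icc a b := ⟨le_rfl, hab.le⟩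
  have hbI : b ∈ Icc a b := ⟨hab.le, le_rfl⟩
  have hGc : ContinuousOn (fun ρ => f ρ - c * ρ + K) (Icc a b) :=
    (hf.continuousOn.sub (by fun_prop)).add (by fun_prop)
  have hGa : f a - c * a + K = 0 := by
    refine aux_lim_bot hw (l := H a) ((hH a haI).hasDerivAt.continuousAt.tendsto.comp hbot) ?_
    exact (hGc a haI).tendsto.comp
      (tendsto_nhdsWithin_iff.2 ⟨hbot, Eventually.of_forall hm⟩)
  have hGb : f b - c * b + K = 0 := by
    refine aux_lim_top hw (l := H b) ((hH b hbI).hasDerivAt.continuousAt.tendsto.comp htop) ?_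
    exact (hGc b hbI).tendsto.comp
      (tendsto_nhdsWithin_iff.2 ⟨htop, Eventually.of_forall hm⟩)
  have hcc : c = (f b - f a) / (b - a) := by
    rw [eq_div_iff (by linarith)]; linarith
  have hG : ∀ ρ, f ρ - c * ρ + K = f ρ - (f a + (f b - f a) / (b - a) * (ρ - a)) := by
    intro ρ; rw [← hcc]; linarith
  have hder : ∀ ξ, φ ξ ∈ Ioo a b → HasDerivAt φ ((f (φ ξ) - c * φ ξ + K) / D (φ ξ)) ξ := by
    intro ξ hξ
    have hs := hH (φ ξ) (Ioo_subset_Icc_self hξ)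
    have hne := (hDpos _ hξ).ne'
    have h1 := (hs.to_localInverse hne).hasDerivAt.comp ξ (hw ξ)
    have h2 := h1.congr_of_eventuallyEq (f₁ := φ) (by
      filter_upwards [hc.continuousAt.eventually (hs.eventually_left_inverse hne)] with x hx
      exact hx.symm)
    rw [div_eq_inv_mul]
    exact h2
  have hnn : ∀ ρ ∈ Ioo a b, 0 ≤ f ρ - c * ρ + K := by
    intro ρ hρ
    obtain ⟨ξ, rfl⟩ := aux_surj hc hbot htop hρ
    have h1 := hmono.deriv_nonneg (x := ξ)
    rw [(hder ξ hρ).deriv] at h1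
    by_contra hneg
    have := div_neg_of_neg_of_pos (not_le.1 hneg) (hDpos _ hρ)
    linarith
  refine ⟨hcc, ?_, fun ξ hξ => hG (φ ξ) ▸ hder ξ hξ⟩
  intro ρ hρ
  have h0 := hnn ρ hρ
  rcases h0.eq_or_lt with h0 | h0
  swap
  · rw [hG] at h0; linarith
  exfalso
  have hnh : Icc a b ∈ 𝓝 ρ := Icc_mem_nhds hρ.1 hρ.2
  have hF : ContDiffAt ℝ 1 (fun ρ => (f ρ - c * ρ + K) / D ρ) ρ :=
    (((hf.contDiffAt hnh).sub (contDiffAt_const.mul contDiffAt_id)).add contDiffAt_const).div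
      (hD.contDiffAt hnh) (hDpos ρ hρ).ne'
  obtain ⟨L, t, ht, hL⟩ := hF.exists_lipschitzOnWith
  have hopen : IsOpen {ξ | φ ξ = ρ} := by
    rw [isOpen_iff_mem_nhds]
    intro ξ hξ
    have hξ' : φ ξ = ρ := hξ
    have hmem : ∀ᶠ x in 𝓝 ξ, φ x ∈ Ioo a b ∩ t := by
      apply hc.continuousAt.eventually
      rw [hξ']
      exact inter_mem (Ioo_mem_nhds hρ.1 hρ.2) ht
    exact ODE_solution_unique_of_eventually (v := fun _ ρ => (f ρ - c * ρ + K) / D ρ)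
      (s := fun _ => t) (K := L) (f := φ) (g := fun _ => ρ) (t₀ := ξ)
      (Eventually.of_forall fun _ => hL)
      (by filter_upwards [hmem] with x hx using ⟨hder x hx.1, hx.2⟩)
      (Eventually.of_forall fun x => ⟨by
        rw [← h0, zero_div]; exact hasDerivAt_const _ _, mem_of_mem_nhds ht⟩) hξ'
  have hclosed : IsClosed {ξ | φ ξ = ρ} := isClosed_eq hc continuous_const
  have huniv := IsClopen.eq_univ ⟨hclosed, hopen⟩ (aux_surj hc hbot htop hρ)
  have hconst : φ = fun _ => ρ := funext fun x => by
    have : x ∈ {ξ | φ ξ = ρ} := huniv ▸ mem_univ x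
    exact this
  rw [hconst] at hbot
  have := tendsto_nhds_unique hbot tendsto_const_nhds
  exact absurd this hρ.1.ne

lemma aux_T {a b : ℝ} (hab : a < b) {r : ℝ → ℝ} (hr : ContinuousOn r (Ioo a b)) :
    ∃ T : ℝ → ℝ, ∀ ρ ∈ Ioo a b, HasDerivAt T (r ρ) ρ := by
  refine ⟨fun u => ∫ t in ((a+b)/2)..u, r t, fun ρ hρ => ?_⟩
  have hmid : (a+b)/2 ∈ Ioo a b := ⟨by linarith, by linarith⟩
  refine intervalIntegral.integral_hasDerivAt_right ?_ ?_ (hr.continuousAt (Ioo_mem_nhds hρ.1 hρ.2))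
  · exact (hr.mono (ordConnected_Ioo.uIcc_subset hmid hρ)).intervalIntegrable
  · exact hr.stronglyMeasurableAtFilter isOpen_Ioo ρ hρ

lemma aux_char {a b : ℝ} (hab : a < b) {r T φ : ℝ → ℝ}
    (hr : ∀ ρ ∈ Ioo a b, 0 < r ρ)
    (hT : ∀ ρ ∈ Ioo a b, HasDerivAt T (r ρ) ρ)
    (hc : Continuous φ) (hmono : Monotone φ)
    (hbot : Tendsto φ atBot (𝓝 a)) (htop : Tendsto φ atTop (𝓝 b))
    (hder : ∀ ξ, φ ξ ∈ Ioo a b → HasDerivAt φ (r (φ ξ))⁻¹ ξ) :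
    ∃ ξ₁, ∀ ρ ∈ Ioo a b, ∀ ξ, φ ξ = ρ ↔ ξ = ξ₁ + T ρ := by
  have hJo : IsOpen (φ ⁻¹' Ioo a b) := isOpen_Ioo.preimage hc
  have hJp : IsPreconnected (φ ⁻¹' Ioo a b) :=
    (ordConnected_Ioo.preimage_mono hmono).isPreconnected
  have hd : ∀ ξ ∈ φ ⁻¹' Ioo a b, HasDerivAt (fun x => x - T (φ x)) 0 ξ := by
    intro ξ hξ
    have h1 := (hT _ hξ).comp ξ (hder ξ hξ)
    rw [mul_inv_cancel₀ (hr _ hξ).ne'] at h1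
    have h2 := (hasDerivAt_id ξ).sub h1
    rw [sub_self] at h2
    exact h2
  have hmid : (a+b)/2 ∈ Ioo a b := ⟨by linarith, by linarith⟩
  obtain ⟨ξ₀, h0⟩ := aux_surj hc hbot htop hmid
  have h0J : ξ₀ ∈ φ ⁻¹' Ioo a b := by rw [mem_preimage, h0]; exact hmid
  have hfw : ∀ ξ, φ ξ ∈ Ioo a b → ξ - T (φ ξ) = ξ₀ - T (φ ξ₀) := fun ξ hξ =>
    hJo.is_const_of_deriv_eq_zero hJp
      (fun x hx => (hd x hx).differentiableAt.differentiableWithinAt)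
      (fun x hx => (hd x hx).deriv) hξ h0J
  refine ⟨ξ₀ - T (φ ξ₀), fun ρ hρ ξ => ⟨fun h => ?_, fun h => ?_⟩⟩
  · subst h
    linarith [hfw ξ hρ]
  · obtain ⟨η, rfl⟩ := aux_surj hc hbot htop hρ
    have := hfw η hρ
    rw [h]; congr 1; linarith

lemma aux_unique {a b : ℝ} (hab : a < b) {f D : ℝ → ℝ}
    (hf : ContDiffOn ℝ 1 f (Icc a b)) (hD : ContDiffOn ℝ 1 D (Icc a b))
    (hDpos : ∀ ρ ∈ Ioo a b, 0 < D ρ) {c₁ c₂ : ℝ} {φ₁ φ₂ : ℝ → ℝ}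
    (h₁ : IsWavefront a b f D c₁ a b φ₁) (h₂ : IsWavefront a b f D c₂ a b φ₂) :
    ∃ h : ℝ, ∀ ξ, φ₂ ξ = φ₁ (ξ + h) := by
  obtain ⟨-, hpos, hd₁⟩ := aux_main hab hf hD hDpos h₁
  obtain ⟨-, -, hd₂⟩ := aux_main hab hf hD hDpos h₂
  obtain ⟨⟨hc₁, hm₁, -⟩, hmon₁, -, hbot₁, htop₁⟩ := h₁
  obtain ⟨⟨hc₂, hm₂, -⟩, hmon₂, -, hbot₂, htop₂⟩ := h₂
  have hmono₁ := aux_monotone hab hmon₁ hbot₁ htop₁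
  have hmono₂ := aux_monotone hab hmon₂ hbot₂ htop₂
  let r : ℝ → ℝ := fun ρ => D ρ / (f ρ - (f a + (f b - f a) / (b - a) * (ρ - a)))
  have hrpos : ∀ ρ ∈ Ioo a b, 0 < r ρ := fun ρ hρ =>
    div_pos (hDpos ρ hρ) (sub_pos.2 (hpos ρ hρ))
  have hrc : ContinuousOn r (Ioo a b) := by
    refine (hD.continuousOn.mono Ioo_subset_Icc_self).div
      ((hf.continuousOn.mono Ioo_subset_Icc_self).sub (by fun_prop)) ?_
    exact fun ρ hρ => (sub_pos.2 (hpos ρ hρ)).ne'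
  obtain ⟨T, hT⟩ := aux_T hab hrc
  obtain ⟨ξ₁, hx₁⟩ := aux_char hab hrpos hT hc₁ hmono₁ hbot₁ htop₁
    (fun ξ hξ => by simp only [r]; rw [inv_div]; exact hd₁ ξ hξ)
  obtain ⟨ξ₂, hx₂⟩ := aux_char hab hrpos hT hc₂ hmono₂ hbot₂ htop₂
    (fun ξ hξ => by simp only [r]; rw [inv_div]; exact hd₂ ξ hξ)
  have hiff : ∀ ρ ∈ Ioo a b, ∀ ξ, φ₂ ξ = ρ ↔ φ₁ (ξ + (ξ₁ - ξ₂)) = ρ := by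
    intro ρ hρ ξ
    rw [hx₁ ρ hρ, hx₂ ρ hρ]
    constructor <;> intro h <;> linarith
  refine ⟨ξ₁ - ξ₂, fun ξ => ?_⟩
  by_cases h2 : φ₂ ξ ∈ Ioo a b
  · exact ((hiff _ h2 ξ).1 rfl).symm
  by_cases h1 : φ₁ (ξ + (ξ₁ - ξ₂)) ∈ Ioo a b
  · exact (hiff _ h1 ξ).2 rfl
  have hends : ∀ x ∈ Icc a b, x ∉ Ioo a b → x = a ∨ x = b := by
    intro x hx hx'
    rcases hx.1.eq_or_lt with h | h
    · exact Or.inl h.symm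
    · rcases hx.2.eq_or_lt with h' | h'
      · exact Or.inr h'
      · exact absurd ⟨h, h'⟩ hx'
  have hmid : (a+b)/2 ∈ Ioo a b := ⟨by linarith, by linarith⟩
  obtain ⟨ζ, hζ⟩ := aux_surj hc₂ hbot₂ htop₂ hmid
  have hζ' := (hiff _ hmid ζ).1 hζ
  rcases hends _ (hm₂ ξ) h2 with e2 | e2 <;> rcases hends _ (hm₁ _) h1 with e1 | e1
  · rw [e1, e2]
  · exfalso
    have l1 : ξ < ζ := hmono₂.reflect_lt (by rw [hζ, e2]; exact hmid.1)
    have l2 : ζ + (ξ₁ - ξ₂) < ξ + (ξ₁ - ξ₂) := hmono₁.reflect_lt (by rw [hζ', e1]; exact hmid.2)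
    linarith
  · exfalso
    have l1 : ζ < ξ := hmono₂.reflect_lt (by rw [hζ, e2]; exact hmid.2)
    have l2 : ξ + (ξ₁ - ξ₂) < ζ + (ξ₁ - ξ₂) := hmono₁.reflect_lt (by rw [hζ', e1]; exact hmid.1)
    linarith
  · rw [e1, e2]

lemma aux_reg {a b : ℝ} (hab : a < b) {f D : ℝ → ℝ}
    (hf : ContDiffOn ℝ 1 f (Icc a b)) (hD : ContDiffOn ℝ 1 D (Icc a b))
    (hDpos : ∀ ρ ∈ Ioo a b, 0 < D ρ) {c : ℝ} {φ : ℝ → ℝ} (h : IsWavefront a b f D c a b φ) :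
    c = (f b - f a) / (b - a) ∧
      ContDiffOn ℝ 2 φ {ξ | φ ξ ∈ Ioo a b} ∧
      ∀ ξ, φ ξ ∈ Ioo a b → 0 < deriv φ ξ := by
  obtain ⟨hcc, hpos, hd⟩ := aux_main hab hf hD hDpos h
  have hc : Continuous φ := h.1.1
  refine ⟨hcc, ?_, fun ξ hξ => ?_⟩
  swap
  · rw [(hd ξ hξ).deriv]
    exact div_pos (sub_pos.2 (hpos _ hξ)) (hDpos _ hξ)
  have hJo : IsOpen {ξ | φ ξ ∈ Ioo a b} := isOpen_Ioo.preimage hc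
  have hdiff : DifferentiableOn ℝ φ {ξ | φ ξ ∈ Ioo a b} :=
    fun ξ hξ => (hd ξ hξ).differentiableAt.differentiableWithinAt
  have hF : ContDiffOn ℝ 1
      (fun ρ => (f ρ - (f a + (f b - f a) / (b - a) * (ρ - a))) / D ρ) (Ioo a b) :=
    ((hf.mono Ioo_subset_Icc_self).sub (by fun_prop)).div (hD.mono Ioo_subset_Icc_self)
      (fun ρ hρ => (hDpos ρ hρ).ne')
  have hde : EqOn (deriv φ)
      ((fun ρ => (f ρ - (f a + (f b - f a) / (b - a) * (ρ - a))) / D ρ) ∘ φ)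
      {ξ | φ ξ ∈ Ioo a b} := fun ξ hξ => (hd ξ hξ).deriv
  have hmaps : MapsTo φ {ξ | φ ξ ∈ Ioo a b} (Ioo a b) := fun ξ hξ => hξ
  have h1 : ContDiffOn ℝ 1 φ {ξ | φ ξ ∈ Ioo a b} := by
    rw [show (1 : WithTop ℕ∞) = 0 + 1 by norm_num, contDiffOn_succ_iff_deriv_of_isOpen hJo]
    refine ⟨hdiff, by simp, ?_⟩
    rw [contDiffOn_zero]
    exact (hF.continuousOn.comp hc.continuousOn hmaps).congr hde
  rw [show (2 : WithTop ℕ∞) = 1 + 1 by norm_num, contDiffOn_succ_iff_deriv_of_isOpen hJo]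
  refine ⟨hdiff, by simp, ?_⟩
  exact (hF.comp h1 hmaps).congr hde

lemma aux_reflect {a b : ℝ} {f D : ℝ → ℝ} {c l m : ℝ} {φ : ℝ → ℝ}
    (h : IsWavefront a b f D c l m φ) :
    IsWavefront a b (fun x => - f x) D (-c) m l (fun ξ => φ (-ξ)) := by
  obtain ⟨⟨hc, hm, ⟨S, hS, hdiff⟩, hli, hweak⟩, hmon, ⟨x, y, hxy⟩, hbot, htop⟩ := h
  have hder : ∀ ξ, deriv (fun ξ => φ (-ξ)) ξ = - deriv φ (-ξ) := fun ξ => deriv_comp_neg ..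
  refine ⟨⟨hc.comp continuous_neg, fun ξ => hm _, ⟨Neg.neg ⁻¹' S, ?_, ?_⟩, ?_, ?_⟩, ?_,
    ⟨-x, -y, by simpa using hxy⟩, htop.comp tendsto_neg_atBot_atTop,
    hbot.comp tendsto_neg_atTop_atBot⟩
  · exact hS.preimage neg_injective
  · intro ξ hξ
    exact DifferentiableAt.comp ξ (hdiff (-ξ) hξ) differentiableAt_id.neg
  · simp_rw [hder]
    have h1 : LocallyIntegrable (fun ξ => D (φ (-ξ)) * deriv φ (-ξ)) := by
      rw [locallyIntegrable_iff] at hli ⊢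
      intro k hk
      have hk' : IsCompact (Neg.neg ⁻¹' k) := (Homeomorph.neg ℝ).isCompact_preimage.2 hk
      have h2 := ((Measure.measurePreserving_neg (volume : Measure ℝ)).integrableOn_comp_preimage
        (Homeomorph.neg ℝ).measurableEmbedding).2 (hli _ hk')
      rw [← preimage_comp, neg_comp_neg, preimage_id] at h2
      exact h2
    have h3 := h1.neg
    refine h3.congr (Eventually.of_forall fun ξ => ?_)
    simp
  · intro ψ hψ hψc
    have h1 := hweak (fun ξ => ψ (-ξ)) (hψ.comp contDiff_neg)
      (hψc.comp_homeomorph (Homeomorph.neg ℝ))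
    rw [← integral_neg_eq_self] at h1
    rw [← h1]
    apply integral_congr_ae
    refine Eventually.of_forall fun ξ => ?_
    have h2 : deriv (fun ξ => ψ (-ξ)) (-ξ) = - deriv ψ ξ := by
      rw [deriv_comp_neg, neg_neg]
    simp only [hder, h2]
    ring
  · rcases hmon with h | h
    · right; exact fun x y hxy => h (neg_le_neg hxy)
    · left; exact fun x y hxy => h (neg_le_neg hxy)

/-- Existence of a generalized inverse of a strictly increasing function on `(a,b)`. -/
lemma aux_inv {a b : ℝ} (hab : a < b) {T : ℝ → ℝ} (hT : StrictMonoOn T (Ioo a b))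
    (hTc : ContinuousOn T (Ioo a b)) :
    ∃ φ : ℝ → ℝ, Continuous φ ∧ Monotone φ ∧ (∀ ξ, φ ξ ∈ Icc a b) ∧
      (∀ ρ ∈ Ioo a b, φ (T ρ) = ρ) ∧ (∀ ξ, φ ξ ∈ Ioo a b → T (φ ξ) = ξ) := by
  let A : ℝ → Set ℝ := fun ξ => insert a {ρ | ρ ∈ Ioo a b ∧ T ρ ≤ ξ}
  have hne : ∀ ξ, (A ξ).Nonempty := fun ξ => ⟨a, mem_insert _ _⟩
  have hub : ∀ ξ, ∀ x ∈ A ξ, x ≤ b := by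
    rintro ξ x (rfl | hx)
    · exact hab.le
    · exact hx.1.2.le
  have hbd : ∀ ξ, BddAbove (A ξ) := fun ξ => ⟨b, hub ξ⟩
  let φ : ℝ → ℝ := fun ξ => sSup (A ξ)
  have hmono : Monotone φ := by
    intro x y hxy
    refine csSup_le_csSup (hbd y) (hne x) (insert_subset_insert ?_)
    exact fun ρ hρ => ⟨hρ.1, hρ.2.trans hxy⟩
  have hm : ∀ ξ, φ ξ ∈ Icc a b := fun ξ =>
    ⟨le_csSup (hbd ξ) (mem_insert _ _), csSup_le (hne ξ) (hub ξ)⟩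
  have hl : ∀ ρ ∈ Ioo a b, φ (T ρ) = ρ := by
    intro ρ hρ
    apply le_antisymm
    · refine csSup_le (hne _) ?_
      rintro x (rfl | hx)
      · exact hρ.1.le
      · exact (hT.le_iff_le hx.1 hρ).1 hx.2
    · exact le_csSup (hbd _) (mem_insert_of_mem _ ⟨hρ, le_rfl⟩)
  have hc : Continuous φ := by
    have : Fact (a ≤ b) := ⟨hab.le⟩
    let Φ : ℝ → Icc a b := fun ξ => ⟨φ ξ, hm ξ⟩
    have hΦ : Continuous Φ := by
      refine Monotone.continuous_of_denseRange (fun x y hxy => hmono hxy) ?_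
      intro x
      rw [mem_closure_iff]
      intro U hU hxU
      obtain ⟨V, hV, rfl⟩ := isOpen_induced_iff.1 hU
      have hx : (x : ℝ) ∈ closure (Ioo a b) := by
        rw [closure_Ioo hab.ne]; exact x.2
      obtain ⟨y, hyV, hy⟩ := mem_closure_iff.1 hx V hV hxU
      refine ⟨Φ (T y), ?_, mem_range_self _⟩
      simp only [Φ, mem_preimage, hl y hy]
      exact hyV
    exact continuous_subtype_val.comp hΦ
  refine ⟨φ, hc, hmono, hm, hl, fun ξ hξ => ?_⟩
  have hcont : ContinuousAt T (φ ξ) := hTc.continuousAt (Ioo_mem_nhds hξ.1 hξ.2)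
  apply le_antisymm
  · have h1 : Tendsto T (𝓝[<] (φ ξ)) (𝓝 (T (φ ξ))) := hcont.tendsto.mono_left nhdsWithin_le_nhds
    refine le_of_tendsto h1 ?_
    filter_upwards [Ioo_mem_nhdsLT hξ.1] with x hx
    refine (hmono.reflect_lt (a := T x) (b := ξ) ?_).le
    rw [hl x ⟨hx.1, hx.2.trans hξ.2⟩]
    exact hx.2
  · have h1 : Tendsto T (𝓝[>] (φ ξ)) (𝓝 (T (φ ξ))) := hcont.tendsto.mono_left nhdsWithin_le_nhds
    refine ge_of_tendsto h1 ?_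
    filter_upwards [Ioo_mem_nhdsGT hξ.2] with x hx
    refine (hmono.reflect_lt (b := T x) (a := ξ) ?_).le
    rw [hl x ⟨hξ.1.trans hx.1, hx.2⟩]
    exact hx.1

lemma aux_exists {a b : ℝ} (hab : a < b) {f D : ℝ → ℝ}
    (hf : ContDiffOn ℝ 1 f (Icc a b)) (hD : ContDiffOn ℝ 1 D (Icc a b))
    (hDpos : ∀ ρ ∈ Ioo a b, 0 < D ρ)
    (hpos : ∀ ρ ∈ Ioo a b, f a + (f b - f a) / (b - a) * (ρ - a) < f ρ) :
    ∃ c : ℝ, ∃ φ : ℝ → ℝ, IsWavefront a b f D c a b φ := by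
  let g : ℝ → ℝ := fun ρ => f ρ - (f a + (f b - f a) / (b - a) * (ρ - a))
  have hga : g a = 0 := by simp [g]
  have hgb : g b = 0 := by
    have : b - a ≠ 0 := by linarith
    simp only [g]; field_simp; ring
  have hgpos : ∀ ρ ∈ Ioo a b, 0 < g ρ := fun ρ hρ => sub_pos.2 (hpos ρ hρ)
  have hgc : ContinuousOn g (Icc a b) := hf.continuousOn.sub (by fun_prop)
  let r : ℝ → ℝ := fun ρ => D ρ / g ρ
  have hrpos : ∀ ρ ∈ Ioo a b, 0 < r ρ := fun ρ hρ => div_pos (hDpos ρ hρ) (hgpos ρ hρ)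
  have hrc : ContinuousOn r (Ioo a b) :=
    (hD.continuousOn.mono Ioo_subset_Icc_self).div (hgc.mono Ioo_subset_Icc_self)
      fun ρ hρ => (hgpos ρ hρ).ne'
  obtain ⟨T, hT⟩ := aux_T hab hrc
  have hTc : ContinuousOn T (Ioo a b) := fun ρ hρ => (hT ρ hρ).continuousAt.continuousWithinAt
  have hTm : StrictMonoOn T (Ioo a b) := by
    refine strictMonoOn_of_deriv_pos (convex_Ioo a b) hTc ?_
    intro x hx
    rw [interior_Ioo] at hx
    rw [(hT x hx).deriv]; exact hrpos x hx
  obtain ⟨φ, hc, hmono, hm, hl, hr⟩ := aux_inv hab hTm hTc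
  have hbot : Tendsto φ atBot (𝓝 a) := by
    rw [tendsto_order]
    refine ⟨fun x hx => Eventually.of_forall fun ξ => hx.trans_le (hm ξ).1, fun x hx => ?_⟩
    obtain ⟨ρ, h1, h2⟩ := exists_between (lt_min hx hab)
    have hρ : ρ ∈ Ioo a b := ⟨h1, h2.trans_le (min_le_right _ _)⟩
    filter_upwards [eventually_le_atBot (T ρ)] with ξ hξ
    have := hmono hξ
    rw [hl ρ hρ] at this
    exact this.trans_lt (h2.trans_le (min_le_left _ _))
  have htop : Tendsto φ atTop (𝓝 b) := by
    rw [tendsto_order]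
    refine ⟨fun x hx => ?_, fun x hx => Eventually.of_forall fun ξ => (hm ξ).2.trans_lt hx⟩
    obtain ⟨ρ, h1, h2⟩ := exists_between (max_lt hx hab)
    have hρ : ρ ∈ Ioo a b := ⟨(le_max_right _ _).trans_lt h1, h2⟩
    filter_upwards [eventually_ge_atTop (T ρ)] with ξ hξ
    have := hmono hξ
    rw [hl ρ hρ] at this
    exact ((le_max_left _ _).trans_lt h1).trans_le this
  have hder : ∀ ξ, φ ξ ∈ Ioo a b → HasDerivAt φ (r (φ ξ))⁻¹ ξ := by
    intro ξ hξ
    refine HasDerivAt.of_local_left_inverse hc.continuousAt (hT _ hξ) (hrpos _ hξ).ne' ?_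
    filter_upwards [(isOpen_Ioo.preimage hc).mem_nhds hξ] with x hx using hr x hx
  let Sa : Set ℝ := {ξ | φ ξ = a ∧ ∀ y, ξ < y → φ y ≠ a}
  let Sb : Set ℝ := {ξ | φ ξ = b ∧ ∀ y, y < ξ → φ y ≠ b}
  have hSa : Sa.Subsingleton := by
    intro x hx y hy
    rcases lt_trichotomy x y with h | h | h
    · exact absurd hy.1 (hx.2 y h)
    · exact h
    · exact absurd hx.1 (hy.2 x h)
  have hSb : Sb.Subsingleton := by
    intro x hx y hy
    rcases lt_trichotomy x y with h | h | h
    · exact absurd hx.1 (hy.2 x h)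
    · exact h
    · exact absurd hy.1 (hx.2 y h)
  have hS : (Sa ∪ Sb).Countable := hSa.countable.union hSb.countable
  have hall : ∀ ξ ∉ Sa ∪ Sb, DifferentiableAt ℝ φ ξ ∧ D (φ ξ) * deriv φ ξ = g (φ ξ) := by
    intro ξ hξ
    rw [mem_union, not_or] at hξ
    by_cases hJ : φ ξ ∈ Ioo a b
    · refine ⟨(hder ξ hJ).differentiableAt, ?_⟩
      rw [(hder ξ hJ).deriv]
      simp only [r]
      rw [inv_div, mul_div_cancel₀ _ (hDpos _ hJ).ne']
    · by_cases h1 : φ ξ = a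
      · have : ∃ y, ξ < y ∧ φ y = a := by
          by_contra hcon
          push Not at hcon
          exact hξ.1 ⟨h1, hcon⟩
        obtain ⟨y, hy, hya⟩ := this
        have he : φ =ᶠ[𝓝 ξ] fun _ => a := by
          filter_upwards [Iio_mem_nhds hy] with x hx
          exact le_antisymm (hya ▸ hmono (le_of_lt hx)) (hm x).1
        have hd := (hasDerivAt_const ξ a).congr_of_eventuallyEq he
        refine ⟨hd.differentiableAt, ?_⟩
        rw [hd.deriv, h1, hga, mul_zero]
      · have h2 : φ ξ = b := by
          by_contra h2
          exact hJ ⟨lt_of_le_of_ne (hm ξ).1 (Ne.symm h1), lt_of_le_of_ne (hm ξ).2 h2⟩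
        have : ∃ y, y < ξ ∧ φ y = b := by
          by_contra hcon
          push Not at hcon
          exact hξ.2 ⟨h2, hcon⟩
        obtain ⟨y, hy, hya⟩ := this
        have he : φ =ᶠ[𝓝 ξ] fun _ => b := by
          filter_upwards [Ioi_mem_nhds hy] with x hx
          exact le_antisymm (hm x).2 (hya ▸ hmono (le_of_lt hx))
        have hd := (hasDerivAt_const ξ b).congr_of_eventuallyEq he
        refine ⟨hd.differentiableAt, ?_⟩
        rw [hd.deriv, h2, hgb, mul_zero]
  have hae : ∀ᵐ ξ : ℝ, D (φ ξ) * deriv φ ξ = g (φ ξ) := by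
    filter_upwards [hS.ae_notMem volume] with ξ hξ using (hall ξ hξ).2
  have hgφ : Continuous fun ξ => g (φ ξ) := hgc.comp_continuous hc hm
  have hmid : (a+b)/2 ∈ Ioo a b := ⟨by linarith, by linarith⟩
  have hq : a + (b-a)/4 ∈ Ioo a b := ⟨by linarith, by linarith⟩
  refine ⟨(f b - f a) / (b - a), φ,
    ⟨hc, hm, ⟨_, hS, fun ξ hξ => (hall ξ hξ).1⟩, ?_, ?_⟩, Or.inl hmono,
    ⟨T ((a+b)/2), T (a + (b-a)/4), ?_⟩, hbot, htop⟩
  · exact hgφ.locallyIntegrable.congr (by filter_upwards [hae] with ξ hξ using hξ.symm)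
  · intro ψ hψ hψc
    have h1 : ∫ ξ, (D (φ ξ) * deriv φ ξ - f (φ ξ) + (f b - f a) / (b - a) * φ ξ) * deriv ψ ξ
        = ∫ ξ, ((f b - f a) / (b - a) * a - f a) * deriv ψ ξ := by
      apply integral_congr_ae
      filter_upwards [hae] with ξ hξ
      rw [hξ]; simp only [g]; ring
    have h2 : ∫ ξ, deriv ψ ξ = 0 :=
      integral_eq_zero_of_hasDerivAt_of_integrable
        (fun x => (hψ.differentiable (by simp) x).hasDerivAt)
        ((hψ.continuous_deriv (by simp)).integrable_of_hasCompactSupport hψc.deriv)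
        (hψ.continuous.integrable_of_hasCompactSupport hψc)
    rw [h1, integral_const_mul, h2, mul_zero]
  · rw [hl _ hmid, hl _ hq]
    intro h; linarith

/-- Theorem 4.1, cases (a1)-(a2): wavefronts when `D > 0` on `(a,b)`. -/
theorem stmt10 (a b : ℝ) (hab : a < b) (f D : ℝ → ℝ)
    (hf : ContDiffOn ℝ 1 f (Icc a b)) (hD : ContDiffOn ℝ 1 D (Icc a b))
    (hDpos : ∀ ρ ∈ Ioo a b, 0 < D ρ) :
    ((∃ c : ℝ, ∃ φ : ℝ → ℝ, IsWavefront a b f D c a b φ) ↔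
      (∀ ρ ∈ Ioo a b, f a + (f b - f a) / (b - a) * (ρ - a) < f ρ)) ∧
    ((∃ c : ℝ, ∃ φ : ℝ → ℝ, IsWavefront a b f D c b a φ) ↔
      (∀ ρ ∈ Ioo a b, f ρ < f a + (f b - f a) / (b - a) * (ρ - a))) ∧
    (∀ c : ℝ, ∀ φ : ℝ → ℝ, IsWavefront a b f D c a b φ →
      c = (f b - f a) / (b - a) ∧
      ContDiffOn ℝ 2 φ {ξ | φ ξ ∈ Ioo a b} ∧
      ∀ ξ, φ ξ ∈ Ioo a b → 0 < deriv φ ξ) ∧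
    (∀ c : ℝ, ∀ φ : ℝ → ℝ, IsWavefront a b f D c b a φ →
      c = (f b - f a) / (b - a) ∧
      ContDiffOn ℝ 2 φ {ξ | φ ξ ∈ Ioo a b} ∧
      ∀ ξ, φ ξ ∈ Ioo a b → deriv φ ξ < 0) ∧
    (∀ c₁ c₂ : ℝ, ∀ φ₁ φ₂ : ℝ → ℝ, IsWavefront a b f D c₁ a b φ₁ →
      IsWavefront a b f D c₂ a b φ₂ → ∃ h : ℝ, ∀ ξ, φ₂ ξ = φ₁ (ξ + h)) ∧
    (∀ c₁ c₂ : ℝ, ∀ φ₁ φ₂ : ℝ → ℝ, IsWavefront a b f D c₁ b a φ₁ →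
      IsWavefront a b f D c₂ b a φ₂ → ∃ h : ℝ, ∀ ξ, φ₂ ξ = φ₁ (ξ + h)) := by
  have hnf : ContDiffOn ℝ 1 (fun x => - f x) (Icc a b) := hf.neg
  have hlin : ∀ ρ, - f a + (- f b - - f a) / (b - a) * (ρ - a) =
      - (f a + (f b - f a) / (b - a) * (ρ - a)) := by
    intro ρ; ring
  refine ⟨⟨?_, ?_⟩, ⟨?_, ?_⟩, ?_, ?_, ?_, ?_⟩
  · rintro ⟨c, φ, h⟩
    exact (aux_main hab hf hD hDpos h).2.1
  · exact aux_exists hab hf hD hDpos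
  · rintro ⟨c, φ, h⟩ ρ hρ
    have h1 := (aux_main hab hnf hD hDpos (aux_reflect h)).2.1 ρ hρ
    simp only [hlin] at h1
    linarith
  · intro h
    obtain ⟨c, φ, h1⟩ := aux_exists hab hnf hD hDpos (fun ρ hρ => by
      simp only [hlin]; linarith [h ρ hρ])
    have h2 := aux_reflect h1
    simp only [neg_neg] at h2
    exact ⟨_, _, h2⟩
  · intro c φ h
    exact aux_reg hab hf hD hDpos h
  · intro c φ h
    obtain ⟨h1, h2, h3⟩ := aux_reg hab hnf hD hDpos (aux_reflect h)
    refine ⟨?_, ?_, ?_⟩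
    · have : (- f b - - f a) / (b - a) = - ((f b - f a) / (b - a)) := by ring
      linarith
    · have h4 := h2.comp (t := {ξ | φ (-ξ) ∈ Ioo a b}) (s := {ξ | φ ξ ∈ Ioo a b})
        (g := fun ξ => φ (-ξ)) (f := fun ξ => -ξ) contDiff_neg.contDiffOn
        (fun ξ hξ => by simpa using hξ)
      simpa [Function.comp_def] using h4
    · intro ξ hξ
      have h5 := h3 (-ξ) (by simpa using hξ)
      rw [deriv_comp_neg, neg_neg] at h5
      linarith
  · intro c₁ c₂ φ₁ φ₂ h₁ h₂
    exact aux_unique hab hf hD hDpos h₁ h₂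
  · intro c₁ c₂ φ₁ φ₂ h₁ h₂
    obtain ⟨h, hh⟩ := aux_unique hab hnf hD hDpos (aux_reflect h₁) (aux_reflect h₂)
    refine ⟨-h, fun ξ => ?_⟩
    have := hh (-ξ)
    simp only [neg_neg, neg_add] at this
    exact this
end

section
/- Let a < b, let f, D : [a,b] → ℝ be C¹, and assume D(ρ) < 0 for all ρ ∈ (a,b). Let s(ρ) := f(a) + ((f(b) − f(a))/(b − a))(ρ − a). Then: (b1) the equation ρ_t + f(ρ)_x = (D(ρ)ρ_x)_x admits a wavefront whose profile φ satisfies φ(−∞) = b, φ(+∞) = a if and only if f(ρ) > s(ρ) for all ρ ∈ (a,b); (b2) it admits a wavefront with φ(−∞) = a, φ(+∞) = b if and only if f(ρ) < s(ρ) for all ρ ∈ (a,b). In either case the wave speed equals (f(b) − f(a))/(b − a), the profile is unique up to shifts, is C² and strictly monotone on J := {ξ : a < φ(ξ) < b} (decreasing in case (b1), increasing in case (b2)). -/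
open Set Filter MeasureTheory Topology

lemma antideriv_test (η : ℝ → ℝ) (h1 : ContDiff ℝ (⊤ : ℕ∞) η) (h2 : HasCompactSupport η)
    (h3 : ∫ x, η x = 0) :
    ∃ ψ : ℝ → ℝ, ContDiff ℝ (⊤ : ℕ∞) ψ ∧ HasCompactSupport ψ ∧ deriv ψ = η := by
  obtain ⟨R, hR⟩ := h2.isCompact.isBounded.subset_ball 0
  have hsupp : ∀ x, η x ≠ 0 → |x| < R := by
    intro x hx
    have := hR (subset_tsupport η hx)
    simpa using this
  have hz : ∀ x, R ≤ |x| → η x = 0 := by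
    intro x hx
    by_contra h
    exact absurd (hsupp x h) (not_lt.mpr hx)
  have hd : deriv (fun x => ∫ t in (-R)..x, η t) = η := by
    ext x
    exact h1.continuous.deriv_integral η (-R) x
  have hd' : Differentiable ℝ (fun x => ∫ t in (-R)..x, η t) := by
    intro x
    exact (intervalIntegral.integral_hasDerivAt_right (h1.continuous.intervalIntegrable _ _)
      (h1.continuous.stronglyMeasurableAtFilter _ _) h1.continuous.continuousAt).differentiableAt
  refine ⟨fun x => ∫ t in (-R)..x, η t, ?_, ?_, hd⟩
  · rw [contDiff_infty_iff_deriv, hd]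
    exact ⟨hd', h1⟩
  · apply HasCompactSupport.of_support_subset_isCompact (isCompact_Icc (a := -R) (b := R))
    intro x hx
    by_contra hx'
    apply hx
    simp only
    rcases lt_or_ge x (-R) with h | h
    · apply intervalIntegral.integral_zero_ae
      refine Eventually.of_forall ?_
      intro t ht
      rw [uIoc_of_ge h.le] at ht
      apply hz
      have := neg_le_abs t
      linarith [ht.2]
    · have hx2 : R < x := by
        by_contra h'
        exact hx' ⟨h, not_lt.mp h'⟩
      rw [intervalIntegral.integral_eq_integral_of_support_subset, h3]
      intro t ht
      have := abs_lt.mp (hsupp t ht)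
      exact ⟨this.1, by linarith [this.2]⟩

lemma du_bois (g : ℝ → ℝ) (hg : LocallyIntegrable g)
    (h : ∀ ψ : ℝ → ℝ, ContDiff ℝ (⊤ : ℕ∞) ψ → HasCompactSupport ψ → ∫ ξ, g ξ * deriv ψ ξ = 0) :
    ∃ K, ∀ᵐ x, g x = K := by
  let B : ContDiffBump (0 : ℝ) := ⟨1, 2, by norm_num, by norm_num⟩
  let θ : ℝ → ℝ := B.normed volume
  have hθ1 : ContDiff ℝ (⊤ : ℕ∞) θ := B.contDiff_normed
  have hθ2 : HasCompactSupport θ := B.hasCompactSupport_normed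
  have hθ3 : ∫ x, θ x = 1 := B.integral_normed
  have int : ∀ η : ℝ → ℝ, ContDiff ℝ (⊤ : ℕ∞) η → HasCompactSupport η →
      Integrable (fun x => η x * g x) := fun η h1 h2 => by
    simpa using hg.integrable_smul_left_of_hasCompactSupport h1.continuous h2
  refine ⟨∫ x, θ x * g x, ?_⟩
  apply ae_eq_of_integral_contDiff_smul_eq hg (locallyIntegrable_const _)
  intro η h1 h2
  have i1 : Integrable η := h1.continuous.integrable_of_hasCompactSupport h2
  have i2 : Integrable θ := hθ1.continuous.integrable_of_hasCompactSupport hθ2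
  obtain ⟨ψ, p1, p2, p3⟩ := antideriv_test (fun x => η x - (∫ y, η y) * θ x)
    (h1.sub (contDiff_const.mul hθ1)) (h2.sub (hθ2.mul_left))
    (by rw [integral_sub i1 (i2.const_mul _), integral_const_mul, hθ3]; ring)
  have := h ψ p1 p2
  rw [p3] at this
  have e : ∀ x, g x * (η x - (∫ y, η y) * θ x) = η x * g x - (∫ y, η y) * (θ x * g x) := by
    intro x; ring
  simp_rw [e] at this
  rw [integral_sub (int η h1 h2) ((int θ hθ1 hθ2).const_mul _), integral_const_mul] at this
  simp only [smul_eq_mul]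
  rw [integral_mul_const]
  linarith

lemma integral_deriv_test (ψ : ℝ → ℝ) (h1 : ContDiff ℝ (⊤ : ℕ∞) ψ) (h2 : HasCompactSupport ψ) :
    ∫ x, deriv ψ x = 0 := by
  have h1' : ContDiff ℝ 1 ψ := h1.of_le (by exact_mod_cast le_top)
  have hi : Integrable (deriv ψ) :=
    (h1'.continuous_deriv le_rfl).integrable_of_hasCompactSupport h2.deriv
  rw [← intervalIntegral.integral_Iic_add_Ioi (b := 0) hi.integrableOn hi.integrableOn,
    h2.integral_Iic_deriv_eq h1', h2.integral_Ioi_deriv_eq h1']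
  ring

lemma lim_zero_top (φ p q d : ℝ → ℝ) (L Q d0 : ℝ)
    (hd : ∀ᶠ ξ in atTop, HasDerivAt φ (p ξ) ξ) (hL : Tendsto φ atTop (𝓝 L))
    (hq : ∀ᶠ ξ in atTop, d ξ * p ξ = q ξ) (hdt : Tendsto d atTop (𝓝 d0))
    (hQ : Tendsto q atTop (𝓝 Q)) : Q = 0 := by
  obtain ⟨M, hM⟩ := eventually_atTop.mp (hd.and hq)
  have key : ∀ n : ℕ, ∃ ξ ∈ Ioo (M + n) (M + n + 1), p ξ = φ (M + n + 1) - φ (M + n) := by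
    intro n
    have hn : (0 : ℝ) ≤ n := Nat.cast_nonneg n
    obtain ⟨ξ, h1, h2⟩ := exists_hasDerivAt_eq_slope φ p (a := M + n) (b := M + n + 1)
      (by linarith)
      (fun x hx => (hM x (by linarith [hx.1])).1.continuousAt.continuousWithinAt)
      (fun x hx => (hM x (by linarith [hx.1])).1)
    refine ⟨ξ, h1, ?_⟩
    rw [h2]
    simp
  choose s hs hp using key
  have hn : Tendsto (fun n : ℕ => M + (n : ℝ)) atTop atTop :=
    tendsto_atTop_add_const_left _ _ tendsto_natCast_atTop_atTop
  have hn1 : Tendsto (fun n : ℕ => M + (n : ℝ) + 1) atTop atTop :=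
    tendsto_atTop_add_const_right _ _ hn
  have hst : Tendsto s atTop atTop :=
    tendsto_atTop_mono (fun n => (hs n).1.le) hn
  have hp0 : Tendsto (fun n => p (s n)) atTop (𝓝 0) := by
    simp_rw [hp]
    simpa using (hL.comp hn1).sub (hL.comp hn)
  have h1 : Tendsto (fun n => d (s n) * p (s n)) atTop (𝓝 (d0 * 0)) :=
    (hdt.comp hst).mul hp0
  have h2 : Tendsto (fun n => d (s n) * p (s n)) atTop (𝓝 Q) := by
    refine (hQ.comp hst).congr ?_
    intro n
    exact (hM (s n) (by linarith [(hs n).1, Nat.cast_nonneg (α := ℝ) n])).2.symm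
  have := tendsto_nhds_unique h2 h1
  simpa using this

lemma lim_zero_bot (φ p q d : ℝ → ℝ) (L Q d0 : ℝ)
    (hd : ∀ᶠ ξ in atBot, HasDerivAt φ (p ξ) ξ) (hL : Tendsto φ atBot (𝓝 L))
    (hq : ∀ᶠ ξ in atBot, d ξ * p ξ = q ξ) (hdt : Tendsto d atBot (𝓝 d0))
    (hQ : Tendsto q atBot (𝓝 Q)) : Q = 0 := by
  have hn := tendsto_neg_atTop_atBot (G := ℝ)
  have := lim_zero_top (fun x => φ (-x)) (fun x => - p (-x)) (fun x => - q (-x))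
    (fun x => d (-x)) L (-Q) d0 ?_ (hL.comp hn) ?_ (hdt.comp hn) (hQ.comp hn).neg
  · linarith
  · filter_upwards [hn.eventually hd] with x hx
    have := hx.comp x (hasDerivAt_neg x)
    simpa [Function.comp_def] using this
  · filter_upwards [hn.eventually hq] with x hx
    rw [← hx]; ring

lemma const_zero (f D φ : ℝ → ℝ) (c K L : ℝ) (U : Set ℝ) (hU : IsOpen U) (hne : U.Nonempty)
    (hc : ∀ ξ ∈ U, φ ξ = L)
    (hae : ∀ᵐ ξ, D (φ ξ) * deriv φ ξ - f (φ ξ) + c * φ ξ = K) : f L - c * L + K = 0 := by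
  by_contra hcon
  have h0 : volume U = 0 := by
    have : ∀ᵐ ξ, ξ ∉ U := by
      filter_upwards [hae] with ξ hξ hξU
      have : deriv φ ξ = 0 := by
        have : φ =ᶠ[𝓝 ξ] fun _ => L := by
          filter_upwards [hU.mem_nhds hξU] with x hx using hc x hx
        rw [this.deriv_eq]; simp
      rw [this, hc ξ hξU] at hξ
      apply hcon; linarith
    simpa [ae_iff] using this
  exact (hU.measure_pos volume hne).ne' h0

lemma ode (a b : ℝ) (hab : a < b) (f D : ℝ → ℝ)
    (hf : ContDiffOn ℝ 1 f (Icc a b)) (hD : ContDiffOn ℝ 1 D (Icc a b))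
    (hDneg : ∀ ρ ∈ Ioo a b, D ρ < 0) (c : ℝ) (φ : ℝ → ℝ) (hw : IsWavefront a b f D c a b φ) :
    Monotone φ ∧ ∃ K, f a - c * a + K = 0 ∧ f b - c * b + K = 0 ∧
      ∀ ξ, φ ξ ∈ Ioo a b → HasDerivAt φ ((f (φ ξ) - c * φ ξ + K) / D (φ ξ)) ξ := by
  obtain ⟨⟨hcont, hmem, ⟨S, hS, hSd⟩, hloc, hweak⟩, hmono, -, hbot, htop⟩ := hw
  have hm : Monotone φ := by
    rcases hmono with h | h
    · exact h
    · have h1 := h.le_of_tendsto htop 0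
      have h2 := h.ge_of_tendsto hbot 0
      linarith
  refine ⟨hm, ?_⟩
  have hfφ : Continuous (fun ξ => f (φ ξ)) :=
    hf.continuousOn.comp_continuous hcont hmem
  have hDφ : Continuous (fun ξ => D (φ ξ)) :=
    hD.continuousOn.comp_continuous hcont hmem
  obtain ⟨K, hK⟩ := du_bois (fun ξ => D (φ ξ) * deriv φ ξ - f (φ ξ) + c * φ ξ)
    ((hloc.sub hfφ.locallyIntegrable).add (continuous_const.mul hcont).locallyIntegrable) hweak
  have hJ : IsOpen {ξ | φ ξ ∈ Ioo a b} := isOpen_Ioo.preimage hcont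
  have hder : ∀ ξ, φ ξ ∈ Ioo a b → HasDerivAt φ ((f (φ ξ) - c * φ ξ + K) / D (φ ξ)) ξ := by
    intro ξ0 hξ0
    set g : ℝ → ℝ := fun ξ => (f (φ ξ) - c * φ ξ + K) / D (φ ξ) with hg
    have hgc : ContinuousOn g {ξ | φ ξ ∈ Ioo a b} := by
      apply ContinuousOn.div
      · exact ((hfφ.sub (continuous_const.mul hcont)).add continuous_const).continuousOn
      · exact hDφ.continuousOn
      · intro x hx
        exact (hDneg _ hx).ne
    have hgae : ∀ᵐ ξ, φ ξ ∈ Ioo a b → g ξ = deriv φ ξ := by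
      filter_upwards [hK] with ξ hξ hm
      have := (hDneg _ hm).ne
      simp only [hg]
      field_simp
      linarith
    obtain ⟨δ, hδ, hball⟩ := Metric.isOpen_iff.mp hJ ξ0 hξ0
    have hsub : ∀ x ∈ Metric.ball ξ0 δ, uIcc ξ0 x ⊆ {ξ | φ ξ ∈ Ioo a b} := by
      intro x hx
      refine Subset.trans ?_ hball
      rw [← segment_eq_uIcc]
      exact (convex_ball ξ0 δ).segment_subset (Metric.mem_ball_self hδ) hx
    have heq : ∀ x ∈ Metric.ball ξ0 δ, φ x = φ ξ0 + ∫ t in ξ0..x, g t := by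
      intro x hx
      have hgi : IntervalIntegrable g volume ξ0 x := (hgc.mono (hsub x hx)).intervalIntegrable
      have hae : ∀ᵐ t, t ∈ uIoc ξ0 x → g t = deriv φ t := by
        filter_upwards [hgae] with t ht htm
        exact ht (hsub x hx (uIoc_subset_uIcc htm))
      have := integral_eq_of_hasDerivAt_off_countable φ (deriv φ) (a := ξ0) (b := x) hS
        hcont.continuousOn (fun t ht => (hSd t ht.2).hasDerivAt)
        (hgi.congr_ae ((ae_restrict_iff' measurableSet_uIoc).mpr hae))
      rw [intervalIntegral.integral_congr_ae hae, this]
      ring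
    have hg0 : ContinuousAt g ξ0 := hgc.continuousAt (hJ.mem_nhds hξ0)
    have h1 : HasDerivAt (fun x => φ ξ0 + ∫ t in ξ0..x, g t) (g ξ0) ξ0 := by
      apply HasDerivAt.const_add
      apply intervalIntegral.integral_hasDerivAt_right
      · simp
      · exact hgc.stronglyMeasurableAtFilter hJ ξ0 hξ0
      · exact hg0
    apply h1.congr_of_eventuallyEq
    filter_upwards [Metric.ball_mem_nhds ξ0 hδ] with x hx using heq x hx
  refine ⟨K, ?_, ?_, hder⟩
  · by_cases h : ∃ ξ0, φ ξ0 = a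
    · obtain ⟨ξ0, h0⟩ := h
      refine const_zero f D φ c K a (Iio ξ0) isOpen_Iio nonempty_Iio (fun ξ hξ => ?_) hK
      exact le_antisymm (h0 ▸ hm (le_of_lt hξ)) (hmem ξ).1
    · push Not at h
      have hJe : ∀ᶠ ξ in atBot, φ ξ ∈ Ioo a b := by
        filter_upwards [hbot.eventually (gt_mem_nhds hab)] with ξ hξ
        exact ⟨lt_of_le_of_ne (hmem ξ).1 (h ξ).symm, hξ⟩
      have hw : Tendsto φ atBot (𝓝[Icc a b] a) :=
        tendsto_nhdsWithin_iff.mpr ⟨hbot, Eventually.of_forall hmem⟩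
      have haI : a ∈ Icc a b := left_mem_Icc.mpr hab.le
      refine lim_zero_bot φ _ (fun ξ => f (φ ξ) - c * φ ξ + K) (fun ξ => D (φ ξ)) a _ (D a)
        (hJe.mono hder) hbot ?_ ((hD.continuousOn a haI).tendsto.comp hw) ?_
      · filter_upwards [hJe] with ξ hξ
        have := (hDneg _ hξ).ne
        field_simp
      · exact ((((hf.continuousOn a haI).tendsto.comp hw)).sub (hbot.const_mul c)).add_const K
  · by_cases h : ∃ ξ0, φ ξ0 = b
    · obtain ⟨ξ0, h0⟩ := h
      refine const_zero f D φ c K b (Ioi ξ0) isOpen_Ioi nonempty_Ioi (fun ξ hξ => ?_) hK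
      exact le_antisymm (hmem ξ).2 (h0 ▸ hm (le_of_lt hξ))
    · push Not at h
      have hJe : ∀ᶠ ξ in atTop, φ ξ ∈ Ioo a b := by
        filter_upwards [htop.eventually (lt_mem_nhds hab)] with ξ hξ
        exact ⟨hξ, lt_of_le_of_ne (hmem ξ).2 (h ξ)⟩
      have hw : Tendsto φ atTop (𝓝[Icc a b] b) :=
        tendsto_nhdsWithin_iff.mpr ⟨htop, Eventually.of_forall hmem⟩
      have haI : b ∈ Icc a b := right_mem_Icc.mpr hab.le
      refine lim_zero_top φ _ (fun ξ => f (φ ξ) - c * φ ξ + K) (fun ξ => D (φ ξ)) b _ (D b)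
        (hJe.mono hder) htop ?_ ((hD.continuousOn b haI).tendsto.comp hw) ?_
      · filter_upwards [hJe] with ξ hξ
        have := (hDneg _ hξ).ne
        field_simp
      · exact ((((hf.continuousOn b haI).tendsto.comp hw)).sub (htop.const_mul c)).add_const K

/-- The flux minus its chord. -/
noncomputable def hh (a b : ℝ) (f : ℝ → ℝ) (ρ : ℝ) : ℝ :=
  f ρ - (f a + (f b - f a) / (b - a) * (ρ - a))

lemma hh_contDiffOn (a b : ℝ) (f : ℝ → ℝ) (hf : ContDiffOn ℝ 1 f (Icc a b)) :
    ContDiffOn ℝ 1 (hh a b f) (Icc a b) := by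
  unfold hh
  fun_prop

lemma hh_left (a b : ℝ) (f : ℝ → ℝ) : hh a b f a = 0 := by simp [hh]

lemma hh_right (a b : ℝ) (hab : a < b) (f : ℝ → ℝ) : hh a b f b = 0 := by
  have : b - a ≠ 0 := by linarith
  unfold hh; field_simp; ring

lemma surj_of (a b : ℝ) (φ : ℝ → ℝ) (hc : Continuous φ)
    (hbot : Tendsto φ atBot (𝓝 a)) (htop : Tendsto φ atTop (𝓝 b)) :
    ∀ ρ ∈ Ioo a b, ∃ ξ, φ ξ = ρ := by
  intro ρ hρ
  obtain ⟨x, hx⟩ := (hbot.eventually (gt_mem_nhds hρ.1)).exists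
  obtain ⟨y, hy⟩ := (htop.eventually (lt_mem_nhds hρ.2)).exists
  exact mem_range_of_exists_le_of_exists_ge hc ⟨x, hx.le⟩ ⟨y, hy.le⟩

lemma front_props (a b : ℝ) (hab : a < b) (f D : ℝ → ℝ)
    (hf : ContDiffOn ℝ 1 f (Icc a b)) (hD : ContDiffOn ℝ 1 D (Icc a b))
    (hDneg : ∀ ρ ∈ Ioo a b, D ρ < 0) (c : ℝ) (φ : ℝ → ℝ) (hw : IsWavefront a b f D c a b φ) :
    Monotone φ ∧ c = (f b - f a) / (b - a) ∧ (∀ ρ ∈ Ioo a b, hh a b f ρ < 0) ∧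
      (∀ ξ, φ ξ ∈ Ioo a b → HasDerivAt φ (hh a b f (φ ξ) / D (φ ξ)) ξ) := by
  obtain ⟨hm, K, hKa, hKb, hder⟩ := ode a b hab f D hf hD hDneg c φ hw
  obtain ⟨⟨hcont, hmem, -, -, -⟩, -, -, hbot, htop⟩ := hw
  have hba : b - a ≠ 0 := by linarith
  have hc : c = (f b - f a) / (b - a) := by
    field_simp; linarith
  have hd : ∀ ξ, φ ξ ∈ Ioo a b → HasDerivAt φ (hh a b f (φ ξ) / D (φ ξ)) ξ := by
    intro ξ hξ
    have := hder ξ hξ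
    have e : hh a b f (φ ξ) = f (φ ξ) - c * φ ξ + K := by
      unfold hh; rw [← hc]; linarith
    rwa [e]
  refine ⟨hm, hc, ?_, hd⟩
  have hh1 := hh_contDiffOn a b f hf
  intro ρ hρ
  have hsurj := surj_of a b φ hcont hbot htop
  obtain ⟨ξ0, hξ0⟩ := hsurj ρ hρ
  have hnp : hh a b f ρ ≤ 0 := by
    have h1 := hd ξ0 (hξ0 ▸ hρ)
    rw [hξ0] at h1
    have h2 := hm.deriv_nonneg (x := ξ0)
    rw [h1.deriv] at h2
    by_contra hcon
    push Not at hcon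
    have := div_neg_of_pos_of_neg hcon (hDneg ρ hρ)
    linarith
  refine lt_of_le_of_ne hnp ?_
  intro h0
  have hset : {ξ | φ ξ = ρ} = univ := by
    apply IsClopen.eq_univ _ ⟨ξ0, hξ0⟩
    refine ⟨isClosed_eq hcont continuous_const, ?_⟩
    rw [isOpen_iff_mem_nhds]
    intro t ht
    have ht' : φ t = ρ := ht
    have hnh : Icc a b ∈ 𝓝 ρ := Icc_mem_nhds hρ.1 hρ.2
    have hg : ContDiffAt ℝ 1 (fun r => hh a b f r / D r) ρ :=
      (hh1.contDiffAt hnh).div (hD.contDiffAt hnh) (hDneg ρ hρ).ne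
    obtain ⟨k, s, hs, hlip⟩ := hg.exists_lipschitzOnWith
    have := ODE_solution_unique_of_eventually (v := fun _ r => hh a b f r / D r)
      (s := fun _ => s) (K := k) (t₀ := t) (f := φ) (g := fun _ => ρ)
      (Eventually.of_forall fun _ => hlip) ?_ ?_ ht'
    · filter_upwards [this] with x hx using hx
    · have h1 : ∀ᶠ x in 𝓝 t, φ x ∈ s := hcont.continuousAt.eventually (by rwa [ht'])
      have h2 : ∀ᶠ x in 𝓝 t, φ x ∈ Ioo a b :=
        hcont.continuousAt.eventually (by rw [ht']; exact Ioo_mem_nhds hρ.1 hρ.2)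
      filter_upwards [h1, h2] with x hx1 hx2
      exact ⟨hd x hx2, hx1⟩
    · refine Eventually.of_forall fun x => ⟨?_, mem_of_mem_nhds hs⟩
      simp only [h0, zero_div]
      exact hasDerivAt_const x ρ
  obtain ⟨ξ1, hξ1⟩ := hsurj ((ρ + b) / 2) ⟨by linarith [hρ.1, hρ.2], by linarith [hρ.2]⟩
  have : φ ξ1 = ρ := by
    have : ξ1 ∈ {ξ | φ ξ = ρ} := by rw [hset]; trivial
    exact this
  linarith [hρ.2]

lemma front_reg (a b : ℝ) (hab : a < b) (f D : ℝ → ℝ)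
    (hf : ContDiffOn ℝ 1 f (Icc a b)) (hD : ContDiffOn ℝ 1 D (Icc a b))
    (hDneg : ∀ ρ ∈ Ioo a b, D ρ < 0) (c : ℝ) (φ : ℝ → ℝ) (hw : IsWavefront a b f D c a b φ) :
    ContDiffOn ℝ 2 φ {ξ | φ ξ ∈ Ioo a b} ∧ ∀ ξ, φ ξ ∈ Ioo a b → 0 < deriv φ ξ := by
  obtain ⟨hm, hc, hneg, hd⟩ := front_props a b hab f D hf hD hDneg c φ hw
  have hcont := hw.1.1
  have hJ : IsOpen {ξ | φ ξ ∈ Ioo a b} := isOpen_Ioo.preimage hcont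
  have hg : ContDiffOn ℝ 1 (fun r => hh a b f r / D r) (Ioo a b) :=
    ((hh_contDiffOn a b f hf).mono Ioo_subset_Icc_self).div (hD.mono Ioo_subset_Icc_self)
      (fun x hx => (hDneg x hx).ne)
  have hdiff : DifferentiableOn ℝ φ {ξ | φ ξ ∈ Ioo a b} := fun ξ hξ =>
    (hd ξ hξ).differentiableAt.differentiableWithinAt
  have hde : ∀ ξ ∈ {ξ | φ ξ ∈ Ioo a b}, deriv φ ξ = hh a b f (φ ξ) / D (φ ξ) :=
    fun ξ hξ => (hd ξ hξ).deriv
  have h1 : ContDiffOn ℝ 1 φ {ξ | φ ξ ∈ Ioo a b} := by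
    rw [show (1 : WithTop ℕ∞) = 0 + 1 by norm_num, contDiffOn_succ_iff_deriv_of_isOpen hJ]
    refine ⟨hdiff, by simp, ?_⟩
    rw [contDiffOn_zero]
    exact (hg.continuousOn.comp hcont.continuousOn (fun x hx => hx)).congr hde
  constructor
  · rw [show (2 : WithTop ℕ∞) = 1 + 1 by norm_num, contDiffOn_succ_iff_deriv_of_isOpen hJ]
    refine ⟨hdiff, by simp, ?_⟩
    exact (hg.comp h1 (fun x hx => hx)).congr hde
  · intro ξ hξ
    rw [hde ξ hξ]
    exact div_pos_of_neg_of_neg (hneg _ hξ) (hDneg _ hξ)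

/-- The travel time function. -/
noncomputable def GG (a b : ℝ) (f D : ℝ → ℝ) (ρ : ℝ) : ℝ :=
  ∫ r in ((a + b) / 2)..ρ, D r / hh a b f r

lemma GG_deriv (a b : ℝ) (hab : a < b) (f D : ℝ → ℝ)
    (hf : ContDiffOn ℝ 1 f (Icc a b)) (hD : ContDiffOn ℝ 1 D (Icc a b))
    (hneg : ∀ ρ ∈ Ioo a b, hh a b f ρ < 0) :
    ∀ ρ ∈ Ioo a b, HasDerivAt (GG a b f D) (D ρ / hh a b f ρ) ρ := by
  intro ρ hρ
  have hc : ContinuousOn (fun r => D r / hh a b f r) (Ioo a b) :=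
    (hD.continuousOn.mono Ioo_subset_Icc_self).div
      ((hh_contDiffOn a b f hf).continuousOn.mono Ioo_subset_Icc_self)
      (fun x hx => (hneg x hx).ne)
  apply intervalIntegral.integral_hasDerivAt_right
  · apply ContinuousOn.intervalIntegrable
    apply hc.mono
    apply (ordConnected_Ioo (a := a) (b := b)).uIcc_subset _ hρ
    constructor <;> linarith
  · exact hc.stronglyMeasurableAtFilter isOpen_Ioo ρ hρ
  · exact hc.continuousAt (isOpen_Ioo.mem_nhds hρ)

lemma front_time (a b : ℝ) (hab : a < b) (f D : ℝ → ℝ)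
    (hf : ContDiffOn ℝ 1 f (Icc a b)) (hD : ContDiffOn ℝ 1 D (Icc a b))
    (hDneg : ∀ ρ ∈ Ioo a b, D ρ < 0) (c : ℝ) (φ : ℝ → ℝ) (hw : IsWavefront a b f D c a b φ) :
    ∃ k, ∀ ξ, φ ξ ∈ Ioo a b → GG a b f D (φ ξ) - ξ = k := by
  obtain ⟨hm, hc, hneg, hd⟩ := front_props a b hab f D hf hD hDneg c φ hw
  have hcont := hw.1.1
  have hJ : IsOpen {ξ | φ ξ ∈ Ioo a b} := isOpen_Ioo.preimage hcont
  have hder : ∀ ξ ∈ {ξ | φ ξ ∈ Ioo a b}, HasDerivAt (fun ξ => GG a b f D (φ ξ) - ξ) 0 ξ := by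
    intro ξ hξ
    have h1 := ((GG_deriv a b hab f D hf hD hneg (φ ξ) hξ).comp ξ (hd ξ hξ)).sub (hasDerivAt_id ξ)
    have e : D (φ ξ) / hh a b f (φ ξ) * (hh a b f (φ ξ) / D (φ ξ)) - 1 = 0 := by
      have := (hDneg _ hξ).ne
      have := (hneg _ hξ).ne
      field_simp
      ring
    rw [e] at h1
    exact h1
  have hpre : IsPreconnected {ξ | φ ξ ∈ Ioo a b} := by
    apply OrdConnected.isPreconnected
    exact ordConnected_Ioo.preimage_mono hm
  obtain ⟨k, hk⟩ := hJ.exists_is_const_of_deriv_eq_zero hpre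
    (fun ξ hξ => (hder ξ hξ).differentiableAt.differentiableWithinAt)
    (fun ξ hξ => (hder ξ hξ).deriv)
  exact ⟨k, hk⟩

lemma time_le (a b : ℝ) (G φ₁ φ₂ : ℝ → ℝ) (k₁ k₂ : ℝ) (m₁ : Monotone φ₁) (m₂ : Monotone φ₂)
    (s₁ : ∀ ρ ∈ Ioo a b, ∃ ξ, φ₁ ξ = ρ) (s₂ : ∀ ρ ∈ Ioo a b, ∃ ξ, φ₂ ξ = ρ)
    (i₁ : ∀ ξ, φ₁ ξ ∈ Icc a b) (i₂ : ∀ ξ, φ₂ ξ ∈ Icc a b)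
    (h₁ : ∀ ξ, φ₁ ξ ∈ Ioo a b → G (φ₁ ξ) - ξ = k₁)
    (h₂ : ∀ ξ, φ₂ ξ ∈ Ioo a b → G (φ₂ ξ) - ξ = k₂) (ξ η : ℝ) (h : ξ + k₂ = η + k₁) :
    φ₂ ξ ≤ φ₁ η := by
  by_contra hcon
  push Not at hcon
  obtain ⟨ρ, hρ1, hρ2⟩ := exists_between hcon
  have hρ : ρ ∈ Ioo a b := ⟨lt_of_le_of_lt (i₁ η).1 hρ1, lt_of_lt_of_le hρ2 (i₂ ξ).2⟩
  obtain ⟨u, hu⟩ := s₁ ρ hρ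
  obtain ⟨t, ht⟩ := s₂ ρ hρ
  have e1 := h₁ u (hu ▸ hρ)
  have e2 := h₂ t (ht ▸ hρ)
  have l1 : η < u := m₁.reflect_lt (by rwa [hu])
  have l2 : t < ξ := m₂.reflect_lt (by rwa [ht])
  rw [hu] at e1
  rw [ht] at e2
  linarith

lemma front_unique (a b : ℝ) (hab : a < b) (f D : ℝ → ℝ)
    (hf : ContDiffOn ℝ 1 f (Icc a b)) (hD : ContDiffOn ℝ 1 D (Icc a b))
    (hDneg : ∀ ρ ∈ Ioo a b, D ρ < 0) (c₁ c₂ : ℝ) (φ₁ φ₂ : ℝ → ℝ)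
    (hw₁ : IsWavefront a b f D c₁ a b φ₁) (hw₂ : IsWavefront a b f D c₂ a b φ₂) :
    ∃ h : ℝ, ∀ ξ, φ₂ ξ = φ₁ (ξ + h) := by
  obtain ⟨k₁, hk₁⟩ := front_time a b hab f D hf hD hDneg c₁ φ₁ hw₁
  obtain ⟨k₂, hk₂⟩ := front_time a b hab f D hf hD hDneg c₂ φ₂ hw₂
  have m₁ := (front_props a b hab f D hf hD hDneg c₁ φ₁ hw₁).1
  have m₂ := (front_props a b hab f D hf hD hDneg c₂ φ₂ hw₂).1
  have s₁ := surj_of a b φ₁ hw₁.1.1 hw₁.2.2.2.1 hw₁.2.2.2.2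
  have s₂ := surj_of a b φ₂ hw₂.1.1 hw₂.2.2.2.1 hw₂.2.2.2.2
  refine ⟨k₂ - k₁, fun ξ => le_antisymm ?_ ?_⟩
  · exact time_le a b (GG a b f D) φ₁ φ₂ k₁ k₂ m₁ m₂ s₁ s₂ hw₁.1.2.1 hw₂.1.2.1 hk₁ hk₂ _ _
      (by ring)
  · exact time_le a b (GG a b f D) φ₂ φ₁ k₂ k₁ m₂ m₁ s₂ s₁ hw₂.1.2.1 hw₁.1.2.1 hk₂ hk₁ _ _
      (by ring)

/-- Generalized inverse of the travel time. -/
noncomputable def invG (a b : ℝ) (G : ℝ → ℝ) (ξ : ℝ) : ℝ :=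
  sSup (insert a {ρ | ρ ∈ Ioo a b ∧ G ρ ≤ ξ})

lemma invG_bdd (a b : ℝ) (hab : a < b) (G : ℝ → ℝ) (ξ : ℝ) :
    ∀ x ∈ insert a {ρ | ρ ∈ Ioo a b ∧ G ρ ≤ ξ}, x ≤ b := by
  rintro x (rfl | hx)
  · exact hab.le
  · exact hx.1.2.le

lemma invG_mem (a b : ℝ) (hab : a < b) (G : ℝ → ℝ) (ξ : ℝ) : invG a b G ξ ∈ Icc a b := by
  constructor
  · exact le_csSup ⟨b, invG_bdd a b hab G ξ⟩ (mem_insert _ _)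
  · exact csSup_le (insert_nonempty _ _) (invG_bdd a b hab G ξ)

lemma invG_mono (a b : ℝ) (hab : a < b) (G : ℝ → ℝ) : Monotone (invG a b G) := by
  intro x y hxy
  apply csSup_le_csSup ⟨b, invG_bdd a b hab G y⟩ (insert_nonempty _ _)
  apply insert_subset_insert
  rintro r ⟨h1, h2⟩
  exact ⟨h1, h2.trans hxy⟩

lemma invG_left (a b : ℝ) (hab : a < b) (G : ℝ → ℝ) (hG : StrictMonoOn G (Ioo a b))
    (ρ : ℝ) (hρ : ρ ∈ Ioo a b) : invG a b G (G ρ) = ρ := by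
  apply IsGreatest.csSup_eq
  refine ⟨Or.inr ⟨hρ, le_rfl⟩, ?_⟩
  rintro x (rfl | hx)
  · exact hρ.1.le
  · exact (hG.le_iff_le hx.1 hρ).mp hx.2

lemma invG_right (a b : ℝ) (hab : a < b) (G : ℝ → ℝ) (hG : StrictMonoOn G (Ioo a b))
    (hc : ContinuousOn G (Ioo a b)) (ξ : ℝ) (h : invG a b G ξ ∈ Ioo a b) :
    G (invG a b G ξ) = ξ := by
  have hm := invG_mono a b hab G
  have hca : ContinuousAt G (invG a b G ξ) := hc.continuousAt (isOpen_Ioo.mem_nhds h)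
  rcases lt_trichotomy (G (invG a b G ξ)) ξ with hl | he | hl
  · exfalso
    have h1 : ∀ᶠ r in 𝓝 (invG a b G ξ), G r < ξ ∧ r ∈ Ioo a b :=
      (hca.eventually (gt_mem_nhds hl)).and (isOpen_Ioo.mem_nhds h)
    obtain ⟨r, ⟨hr1, hr2⟩, hr3⟩ :=
      ((h1.filter_mono nhdsWithin_le_nhds).and (self_mem_nhdsWithin (s := Ioi (invG a b G ξ)))).exists
    have h2 := hm hr1.le
    rw [invG_left a b hab G hG r hr2] at h2
    exact absurd hr3 (not_lt.mpr h2)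
  · exact he
  · exfalso
    have h1 : ∀ᶠ r in 𝓝 (invG a b G ξ), ξ < G r ∧ r ∈ Ioo a b :=
      (hca.eventually (lt_mem_nhds hl)).and (isOpen_Ioo.mem_nhds h)
    obtain ⟨r, ⟨hr1, hr2⟩, hr3⟩ :=
      ((h1.filter_mono nhdsWithin_le_nhds).and (self_mem_nhdsWithin (s := Iio (invG a b G ξ)))).exists
    have h2 := hm hr1.le
    rw [invG_left a b hab G hG r hr2] at h2
    exact absurd hr3 (not_lt.mpr h2)

lemma invG_cont (a b : ℝ) (hab : a < b) (G : ℝ → ℝ) (hG : StrictMonoOn G (Ioo a b)) :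
    Continuous (invG a b G) := by
  have hm := invG_mono a b hab G
  have hi := invG_mem a b hab G
  have hl := invG_left a b hab G hG
  rw [continuous_iff_continuousAt]
  intro ξ
  refine tendsto_order.mpr ⟨fun y hy => ?_, fun y hy => ?_⟩
  · rcases (hi ξ).1.eq_or_lt with h | h
    · exact Eventually.of_forall fun x => lt_of_lt_of_le hy (h ▸ (hi x).1)
    · obtain ⟨ρ, hρ1, hρ2⟩ := exists_between (max_lt hy h)
      have hρ : ρ ∈ Ioo a b :=
        ⟨lt_of_le_of_lt (le_max_right _ _) hρ1, lt_of_lt_of_le hρ2 (hi ξ).2⟩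
      have h1 : G ρ < ξ := hm.reflect_lt (by rwa [hl ρ hρ])
      filter_upwards [lt_mem_nhds h1] with x hx
      have := hm (le_of_lt hx)
      rw [hl ρ hρ] at this
      exact lt_of_lt_of_le (lt_of_le_of_lt (le_max_left _ _) hρ1) this
  · rcases (hi ξ).2.eq_or_lt with h | h
    · exact Eventually.of_forall fun x => lt_of_le_of_lt ((hi x).2.trans h.ge) hy
    · obtain ⟨ρ, hρ1, hρ2⟩ := exists_between (lt_min hy h)
      have hρ : ρ ∈ Ioo a b :=
        ⟨lt_of_le_of_lt (hi ξ).1 hρ1, lt_of_lt_of_le hρ2 (min_le_right _ _)⟩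
      have h1 : ξ < G ρ := hm.reflect_lt (by rwa [hl ρ hρ])
      filter_upwards [gt_mem_nhds h1] with x hx
      have := hm (le_of_lt hx)
      rw [hl ρ hρ] at this
      exact lt_of_le_of_lt this (lt_of_lt_of_le hρ2 (min_le_left _ _))

lemma invG_top (a b : ℝ) (hab : a < b) (G : ℝ → ℝ) (hG : StrictMonoOn G (Ioo a b)) :
    Tendsto (invG a b G) atTop (𝓝 b) := by
  have hm := invG_mono a b hab G
  have hi := invG_mem a b hab G
  have hl := invG_left a b hab G hG
  refine tendsto_order.mpr ⟨fun y hy => ?_, fun y hy => ?_⟩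
  · obtain ⟨ρ, hρ1, hρ2⟩ := exists_between (max_lt hy hab)
    have hρ : ρ ∈ Ioo a b := ⟨lt_of_le_of_lt (le_max_right _ _) hρ1, hρ2⟩
    filter_upwards [eventually_ge_atTop (G ρ)] with x hx
    have := hm hx
    rw [hl ρ hρ] at this
    exact lt_of_lt_of_le (lt_of_le_of_lt (le_max_left _ _) hρ1) this
  · exact Eventually.of_forall fun x => lt_of_le_of_lt (hi x).2 hy

lemma invG_bot (a b : ℝ) (hab : a < b) (G : ℝ → ℝ) (hG : StrictMonoOn G (Ioo a b)) :
    Tendsto (invG a b G) atBot (𝓝 a) := by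
  have hm := invG_mono a b hab G
  have hi := invG_mem a b hab G
  have hl := invG_left a b hab G hG
  refine tendsto_order.mpr ⟨fun y hy => ?_, fun y hy => ?_⟩
  · exact Eventually.of_forall fun x => lt_of_lt_of_le hy (hi x).1
  · obtain ⟨ρ, hρ1, hρ2⟩ := exists_between (lt_min hy hab)
    have hρ : ρ ∈ Ioo a b := ⟨hρ1, lt_of_lt_of_le hρ2 (min_le_right _ _)⟩
    filter_upwards [eventually_le_atBot (G ρ)] with x hx
    have := hm hx
    rw [hl ρ hρ] at this
    exact lt_of_le_of_lt this (lt_of_lt_of_le hρ2 (min_le_left _ _))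

lemma front_exists (a b : ℝ) (hab : a < b) (f D : ℝ → ℝ)
    (hf : ContDiffOn ℝ 1 f (Icc a b)) (hD : ContDiffOn ℝ 1 D (Icc a b))
    (hDneg : ∀ ρ ∈ Ioo a b, D ρ < 0) (hneg : ∀ ρ ∈ Ioo a b, hh a b f ρ < 0) :
    ∃ φ, IsWavefront a b f D ((f b - f a) / (b - a)) a b φ := by
  have hGd := GG_deriv a b hab f D hf hD hneg
  set G := GG a b f D with hGdef
  have hGc : ContinuousOn G (Ioo a b) := fun x hx => (hGd x hx).continuousAt.continuousWithinAt
  have hGm : StrictMonoOn G (Ioo a b) := by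
    apply strictMonoOn_of_deriv_pos (convex_Ioo a b) hGc
    intro x hx
    rw [interior_Ioo] at hx
    rw [(hGd x hx).deriv]
    exact div_pos_of_neg_of_neg (hDneg x hx) (hneg x hx)
  have hm := invG_mono a b hab G
  have hi := invG_mem a b hab G
  have hl := invG_left a b hab G hGm
  have hr := invG_right a b hab G hGm hGc
  have hc := invG_cont a b hab G hGm
  have ht := invG_top a b hab G hGm
  have hb := invG_bot a b hab G hGm
  set φ := invG a b G with hφ
  have hJ : IsOpen {ξ | φ ξ ∈ Ioo a b} := isOpen_Ioo.preimage hc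
  have hdJ : ∀ ξ, φ ξ ∈ Ioo a b → HasDerivAt φ (hh a b f (φ ξ) / D (φ ξ)) ξ := by
    intro ξ hξ
    have h1 := HasDerivAt.of_local_left_inverse (hc.continuousAt (x := ξ)) (hGd (φ ξ) hξ)
      (div_pos_of_neg_of_neg (hDneg _ hξ) (hneg _ hξ)).ne' ?_
    · rwa [inv_div] at h1
    · filter_upwards [hJ.mem_nhds hξ] with y hy using hr y hy
  let S : Set ℝ := {sSup {ξ | φ ξ = a}, sInf {ξ | φ ξ = b}}
  have hS : S.Countable := (Set.toFinite S).countable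
  have hcon : ∀ ξ L, φ =ᶠ[𝓝 ξ] (fun _ => L) → HasDerivAt φ 0 ξ := fun ξ L h =>
    (hasDerivAt_const ξ L).congr_of_eventuallyEq h
  have key : ∀ ξ ∉ S, DifferentiableAt ℝ φ ξ ∧ D (φ ξ) * deriv φ ξ = hh a b f (φ ξ) := by
    intro ξ hξ
    simp only [S, mem_insert_iff, mem_singleton_iff, not_or] at hξ
    rcases (hi ξ).1.eq_or_lt with h | h
    · have hbdd : BddAbove {ξ | φ ξ = a} := by
        obtain ⟨M, hM⟩ := eventually_atTop.mp (ht.eventually (lt_mem_nhds hab))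
        refine ⟨M, fun x hx => ?_⟩
        by_contra hx'
        have := hM x (not_le.mp hx').le
        rw [show φ x = a from hx] at this
        exact lt_irrefl _ this
      have hlt : ξ < sSup {ξ | φ ξ = a} := lt_of_le_of_ne (le_csSup hbdd h.symm) hξ.1
      obtain ⟨x, hx, hx2⟩ := exists_lt_of_lt_csSup ⟨ξ, h.symm⟩ hlt
      have hd : HasDerivAt φ 0 ξ := by
        apply hcon ξ a
        filter_upwards [gt_mem_nhds hx2] with y hy
        exact le_antisymm ((hm (le_of_lt hy)).trans (le_of_eq hx)) (hi y).1
      refine ⟨hd.differentiableAt, ?_⟩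
      rw [hd.deriv, ← h, hh_left]; simp
    · rcases (hi ξ).2.eq_or_lt with h' | h'
      · have hbdd : BddBelow {ξ | φ ξ = b} := by
          obtain ⟨M, hM⟩ := eventually_atBot.mp (hb.eventually (gt_mem_nhds hab))
          refine ⟨M, fun x hx => ?_⟩
          by_contra hx'
          have := hM x (not_le.mp hx').le
          rw [show φ x = b from hx] at this
          exact lt_irrefl _ this
        have hlt : sInf {ξ | φ ξ = b} < ξ := lt_of_le_of_ne (csInf_le hbdd h') (Ne.symm hξ.2)
        obtain ⟨x, hx, hx2⟩ := exists_lt_of_csInf_lt ⟨ξ, h'⟩ hlt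
        have hd : HasDerivAt φ 0 ξ := by
          apply hcon ξ b
          filter_upwards [lt_mem_nhds hx2] with y hy
          exact le_antisymm (hi y).2 ((le_of_eq (Eq.symm hx)).trans (hm (le_of_lt hy)))
        refine ⟨hd.differentiableAt, ?_⟩
        rw [hd.deriv, h', hh_right a b hab]; simp
      · have hd := hdJ ξ ⟨h, h'⟩
        refine ⟨hd.differentiableAt, ?_⟩
        rw [hd.deriv]
        have := (hDneg _ ⟨h, h'⟩).ne
        field_simp
  have hae : ∀ᵐ ξ, D (φ ξ) * deriv φ ξ = hh a b f (φ ξ) := by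
    filter_upwards [hS.ae_notMem volume] with ξ hξ using (key ξ hξ).2
  have hhc : Continuous (fun ξ => hh a b f (φ ξ)) :=
    (hh_contDiffOn a b f hf).continuousOn.comp_continuous hc hi
  refine ⟨φ, ⟨hc, hi, ⟨S, hS, fun ξ hξ => (key ξ hξ).1⟩, ?_, ?_⟩, Or.inl hm, ?_, hb, ht⟩
  · exact hhc.locallyIntegrable.congr (hae.mono fun x hx => hx.symm)
  · intro ψ h1 h2
    have : ∀ᵐ ξ, (D (φ ξ) * deriv φ ξ - f (φ ξ) + (f b - f a) / (b - a) * φ ξ) * deriv ψ ξ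
        = (- f a + (f b - f a) / (b - a) * a) * deriv ψ ξ := by
      filter_upwards [hae] with ξ hξ
      rw [hξ]
      unfold hh
      ring
    rw [integral_congr_ae this, integral_const_mul, integral_deriv_test ψ h1 h2, mul_zero]
  · refine ⟨G ((a + b) / 2), G ((3 * a + b) / 4), ?_⟩
    rw [hl _ ⟨by linarith, by linarith⟩, hl _ ⟨by linarith, by linarith⟩]
    intro h
    linarith

lemma reflect (a b : ℝ) (f D : ℝ → ℝ) (c l r : ℝ) (φ : ℝ → ℝ)
    (hw : IsWavefront a b f D c l r φ) :
    IsWavefront a b (fun x => - f x) D (-c) r l (fun x => φ (-x)) := by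
  obtain ⟨⟨hcont, hmem, ⟨S, hS, hSd⟩, hloc, hweak⟩, hmono, ⟨x, y, hxy⟩, hbot, htop⟩ := hw
  have hde : ∀ ξ, deriv (fun x => φ (-x)) ξ = - deriv φ (-ξ) := fun ξ => deriv_comp_neg φ ξ
  refine ⟨⟨hcont.comp continuous_neg, fun ξ => hmem _, ⟨Neg.neg ⁻¹' S, ?_, ?_⟩, ?_, ?_⟩, ?_,
    ⟨-x, -y, by simpa using hxy⟩, htop.comp tendsto_neg_atBot_atTop,
    hbot.comp tendsto_neg_atTop_atBot⟩
  · exact hS.preimage neg_injective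
  · intro ξ hξ
    exact (hSd (-ξ) hξ).comp ξ differentiable_neg.differentiableAt
  · simp_rw [hde]
    intro ξ
    have h1 := hloc (-ξ)
    have h2 : IntegrableAtFilter (fun ξ => D (φ (-ξ)) * deriv φ (-ξ)) (𝓝 ξ) := by
      obtain ⟨s, hs, his⟩ := h1
      refine ⟨Neg.neg ⁻¹' s, continuous_neg.continuousAt hs, ?_⟩
      exact ((Measure.measurePreserving_neg (volume : Measure ℝ)).integrableOn_comp_preimage
        (MeasurableEquiv.neg ℝ).measurableEmbedding).mpr his
    have h3 := h2.neg
    have e : (fun ξ => D (φ (-ξ)) * -deriv φ (-ξ)) = -fun ξ => D (φ (-ξ)) * deriv φ (-ξ) := by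
      funext t
      exact mul_neg (D (φ (-t))) (deriv φ (-t))
    rw [e]
    exact h3
  · intro ψ h1 h2
    have h3 := hweak (fun x => ψ (-x)) (h1.comp contDiff_neg)
      (h2.comp_homeomorph (Homeomorph.neg ℝ))
    rw [← integral_neg_eq_self] at h3
    rw [← h3]
    congr 1
    ext ξ
    rw [hde, deriv_comp_neg ψ]
    simp only [neg_neg]
    ring
  · rcases hmono with h | h
    · exact Or.inr fun x y hxy => h (neg_le_neg hxy)
    · exact Or.inl fun x y hxy => h (neg_le_neg hxy)

lemma hh_neg (a b : ℝ) (f : ℝ → ℝ) (ρ : ℝ) : hh a b (fun x => - f x) ρ = - hh a b f ρ := by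
  unfold hh; ring

/-- Theorem 4.1, cases (b1)-(b2): wavefronts when `D < 0` on `(a,b)`. -/
theorem stmt11 (a b : ℝ) (hab : a < b) (f D : ℝ → ℝ)
    (hf : ContDiffOn ℝ 1 f (Icc a b)) (hD : ContDiffOn ℝ 1 D (Icc a b))
    (hDneg : ∀ ρ ∈ Ioo a b, D ρ < 0) :
    ((∃ c : ℝ, ∃ φ : ℝ → ℝ, IsWavefront a b f D c b a φ) ↔
      (∀ ρ ∈ Ioo a b, f a + (f b - f a) / (b - a) * (ρ - a) < f ρ)) ∧
    ((∃ c : ℝ, ∃ φ : ℝ → ℝ, IsWavefront a b f D c a b φ) ↔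
      (∀ ρ ∈ Ioo a b, f ρ < f a + (f b - f a) / (b - a) * (ρ - a))) ∧
    (∀ c : ℝ, ∀ φ : ℝ → ℝ, IsWavefront a b f D c b a φ →
      c = (f b - f a) / (b - a) ∧
      ContDiffOn ℝ 2 φ {ξ | φ ξ ∈ Ioo a b} ∧
      ∀ ξ, φ ξ ∈ Ioo a b → deriv φ ξ < 0) ∧
    (∀ c : ℝ, ∀ φ : ℝ → ℝ, IsWavefront a b f D c a b φ →
      c = (f b - f a) / (b - a) ∧
      ContDiffOn ℝ 2 φ {ξ | φ ξ ∈ Ioo a b} ∧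
      ∀ ξ, φ ξ ∈ Ioo a b → 0 < deriv φ ξ) ∧
    (∀ c₁ c₂ : ℝ, ∀ φ₁ φ₂ : ℝ → ℝ, IsWavefront a b f D c₁ b a φ₁ →
      IsWavefront a b f D c₂ b a φ₂ → ∃ h : ℝ, ∀ ξ, φ₂ ξ = φ₁ (ξ + h)) ∧
    (∀ c₁ c₂ : ℝ, ∀ φ₁ φ₂ : ℝ → ℝ, IsWavefront a b f D c₁ a b φ₁ →
      IsWavefront a b f D c₂ a b φ₂ → ∃ h : ℝ, ∀ ξ, φ₂ ξ = φ₁ (ξ + h)) := by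
  have hfn : ContDiffOn ℝ 1 (fun x => - f x) (Icc a b) := hf.neg
  have back : ∀ c φ, IsWavefront a b (fun x => - f x) D c a b φ →
      IsWavefront a b f D (-c) b a (fun x => φ (-x)) := by
    intro c φ h
    simpa using reflect a b _ D c a b φ h
  have forw : ∀ c φ, IsWavefront a b f D c b a φ →
      IsWavefront a b (fun x => - f x) D (-c) a b (fun x => φ (-x)) := fun c φ h =>
    reflect a b f D c b a φ h
  refine ⟨⟨?_, ?_⟩, ⟨?_, ?_⟩, ?_, ?_, ?_, ?_⟩
  · rintro ⟨c, φ, h⟩ ρ hρ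
    have := (front_props a b hab _ D hfn hD hDneg _ _ (forw c φ h)).2.2.1 ρ hρ
    rw [hh_neg] at this
    unfold hh at this
    linarith
  · intro h
    obtain ⟨φ, hφ⟩ := front_exists a b hab _ D hfn hD hDneg (fun ρ hρ => by
      have := h ρ hρ
      rw [hh_neg]
      unfold hh
      linarith)
    exact ⟨_, _, back _ φ hφ⟩
  · rintro ⟨c, φ, h⟩ ρ hρ
    have := (front_props a b hab _ D hf hD hDneg _ _ h).2.2.1 ρ hρ
    unfold hh at this
    linarith
  · intro h
    obtain ⟨φ, hφ⟩ := front_exists a b hab _ D hf hD hDneg (fun ρ hρ => by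
      have := h ρ hρ
      unfold hh
      linarith)
    exact ⟨_, _, hφ⟩
  · intro c φ h
    have h' := forw c φ h
    have h1 := (front_props a b hab _ D hfn hD hDneg _ _ h').2.1
    obtain ⟨h2, h3⟩ := front_reg a b hab _ D hfn hD hDneg _ _ h'
    refine ⟨?_, ?_, ?_⟩
    · rw [← neg_neg c, h1]; ring
    · have := h2.comp (contDiff_neg.contDiffOn (s := {ξ | φ ξ ∈ Ioo a b})) (fun x hx => by simpa using hx)
      simpa [Function.comp_def] using this
    · intro ξ hξ
      have := h3 (-ξ) (by simpa using hξ)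
      rw [deriv_comp_neg φ, neg_neg] at this
      linarith
  · intro c φ h
    exact ⟨(front_props a b hab _ D hf hD hDneg _ _ h).2.1,
      front_reg a b hab _ D hf hD hDneg _ _ h⟩
  · intro c₁ c₂ φ₁ φ₂ h₁ h₂
    obtain ⟨k, hk⟩ := front_unique a b hab _ D hfn hD hDneg _ _ _ _ (forw _ _ h₁) (forw _ _ h₂)
    refine ⟨-k, fun ξ => ?_⟩
    have := hk (-ξ)
    simp only [neg_neg] at this
    rw [this]
    congr 1
    ring
  · intro c₁ c₂ φ₁ φ₂ h₁ h₂
    exact front_unique a b hab _ D hf hD hDneg _ _ _ _ h₁ h₂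
end
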